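/- arXiv:0706.3338 — 2 statements merged into one kernel-verified Lean document; each statement's English description precedes it below -/
import Mathlib

section
/- Let Φ be a free group, P = ⟨x, Φ; R⟩ an M_Φ-presentation, and K = ⟨y, z; S(y,z)⟩ a one-relator group (y a set, z a single generator not in y, S a word on y ∪ {z}). Then the one-relator group K̄ = ⟨x, y, Φ; S(y, R)⟩, obtained by substituting R for every occurrence of z^{±1} in S, is residually finite if and only if K is residually finite. -/
open Monoid

section Defs
variable {X Y H : Type*}

/-- `φ_W^θ(j)`: the sum `Σ_{i=1}^{j} ε_i θ(x_i)` of the weights of the first `j`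
letters of the word `W` (a word is a nonempty list of pairs (letter, exponent sign)). -/
def phiW (θ : X → ℤ) (W : List (X × Bool)) (j : ℕ) : ℤ :=
  ((W.take j).map fun p => if p.2 then θ p.1 else -θ p.1).sum

/-- A weight function: a map `θ : X → ℤ` whose image generates the additive group `ℤ`. -/
def IsWeightFun (θ : X → ℤ) : Prop :=
  AddSubgroup.closure (Set.range θ) = ⊤

/-- A strict weight function: `θ x ≠ 0` for all `x`. -/
def IsStrictWeight (θ : X → ℤ) : Prop := ∀ x, θ x ≠ 0

/-- `θ` is admissible for `W` if `φ(r) = 0` where `r` is the length of `W`. -/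
def IsAdmissible (θ : X → ℤ) (W : List (X × Bool)) : Prop :=
  phiW θ W W.length = 0

/-- The successor of an index, cyclically (subscripts mod `r`). -/
def succIdx (W : List (X × Bool)) (k : Fin W.length) : Fin W.length :=
  ⟨(k.1 + 1) % W.length, Nat.mod_lt _ k.pos⟩

/-- `W` has the unique max-min property with respect to the weight function `θ`:
`θ` is a strict weight function, admissible for `W`, the graph of `W` has a unique
maximum at `k` and a unique minimum at `l`, and `W` is reduced at the maximum and
minimum (`x_k ≠ x_{k+1}`, `x_l ≠ x_{l+1}`, subscripts mod `r`). -/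
def UniqueMaxMinWith (θ : X → ℤ) (W : List (X × Bool)) : Prop :=
  W ≠ [] ∧ IsWeightFun θ ∧ IsStrictWeight θ ∧ IsAdmissible θ W ∧
  ∃ k l : Fin W.length,
    (∀ j : Fin W.length, j ≠ k → phiW θ W (j.1 + 1) < phiW θ W (k.1 + 1)) ∧
    (∀ j : Fin W.length, j ≠ l → phiW θ W (l.1 + 1) < phiW θ W (j.1 + 1)) ∧
    (W.get k).1 ≠ (W.get (succIdx W k)).1 ∧
    (W.get l).1 ≠ (W.get (succIdx W l)).1

/-- `W` has the unique max-min property: it has it with respect to some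
admissible strict weight function. -/
def HasUniqueMaxMin (W : List (X × Bool)) : Prop :=
  ∃ θ : X → ℤ, UniqueMaxMinWith θ W

/-- The `x`-skeleton of a relator `R = x₁^{ε₁} h₁ ⋯ x_r^{ε_r} h_r`
(encoded as the list of triples `(xᵢ, εᵢ, hᵢ)`): the word `x₁^{ε₁} ⋯ x_r^{ε_r}`. -/
def skel (R : List (X × Bool × H)) : List (X × Bool) :=
  R.map fun t => (t.1, t.2.1)

variable [Group H]

/-- The element of the free product `H ∗ F(X)` represented by the relator
`R = x₁^{ε₁} h₁ ⋯ x_r^{ε_r} h_r`. -/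
def relWord (R : List (X × Bool × H)) : Coprod H (FreeGroup X) :=
  (R.map fun t => Coprod.inr (FreeGroup.mk [(t.1, t.2.1)]) * Coprod.inl t.2.2).prod

/-- The group `G(P)` defined by the relative one-relator presentation
`P = ⟨x, H; R⟩`: the quotient of `H ∗ F(X)` by the normal closure of `R`. -/
def relGroup (R : List (X × Bool × H)) : Type _ :=
  Coprod H (FreeGroup X) ⧸ Subgroup.normalClosure {relWord R}

instance (R : List (X × Bool × H)) : Group (relGroup R) :=
  QuotientGroup.Quotient.group _

/-- The natural homomorphism `ν : H → G(P)`. -/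
def natHom (R : List (X × Bool × H)) : H →* relGroup R :=
  (QuotientGroup.mk' _).comp Coprod.inl

end Defs

/-- A group is residually finite if every nontrivial element is sent to a
nontrivial element by some homomorphism to a finite group. -/
def ResiduallyFinite (G : Type*) [Group G] : Prop :=
  ∀ g : G, g ≠ 1 → ∃ (Q : Type) (_ : Group Q) (_ : Finite Q) (f : G →* Q), f g ≠ 1

section Subst
variable {X Y H : Type*} [Group H]

/-- The embedding `H ∗ F(X) → H ∗ F(X ⊔ Y)` induced by the inclusion `X → X ⊔ Y`. -/
def coprodInlX : Coprod H (FreeGroup X) →* Coprod H (FreeGroup (X ⊕ Y)) :=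
  Coprod.map (MonoidHom.id H) (FreeGroup.map Sum.inl)

/-- Given a relator `R` on `x^{±1} ∪ H` and a word `S = S(y,z)` on `(y ∪ {z})^{±1}`
(the letter `z` is encoded as `none`, and `y ∈ y` as `some y`), the element of
`H ∗ F(X ⊔ Y)` represented by the word `S(y, R)` obtained from `S` by substituting
`R^{±1}` for every occurrence of `z^{±1}`. -/
def substWord (R : List (X × Bool × H)) (S : List (Option Y × Bool)) :
    Coprod H (FreeGroup (X ⊕ Y)) :=
  (S.map fun p => match p.1 with
    | none => if p.2 then coprodInlX (relWord R) else (coprodInlX (relWord R))⁻¹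
    | some y => Coprod.inr (FreeGroup.mk [(Sum.inr y, p.2)])).prod

/-- The group defined by the relative presentation `⟨x, y, H; S(y, R)⟩`. -/
def substGroup (R : List (X × Bool × H)) (S : List (Option Y × Bool)) : Type _ :=
  Coprod H (FreeGroup (X ⊕ Y)) ⧸ Subgroup.normalClosure {substWord R S}

instance (R : List (X × Bool × H)) (S : List (Option Y × Bool)) :
    Group (substGroup R S) := QuotientGroup.Quotient.group _

end Subst

/-- The one-relator group `K = ⟨y, z; S(y,z)⟩` given by an ordinary presentation
with a single relator `S`, a word on the alphabet `y ∪ {z}` (the letter `z` is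
encoded as `none`). -/
def oneRelatorGroup {Y : Type*} (S : List (Option Y × Bool)) : Type _ :=
  FreeGroup (Option Y) ⧸ Subgroup.normalClosure {FreeGroup.mk S}

instance {Y : Type*} (S : List (Option Y × Bool)) : Group (oneRelatorGroup S) :=
  QuotientGroup.Quotient.group _

/-- Action of a list of letters of a free product on a point, through permutation
representations of the factors. -/
def actList {J Ω : Type*} {M : J → Type*} [∀ j, Group (M j)] (τ : ∀ j, M j →* Equiv.Perm Ω)
    (l : List (Σ j, M j)) (ω : Ω) : Ω :=
  l.foldr (fun a p => τ a.1 a.2 p) ω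

theorem exists_actList_ne {J : Type*} {M : J → Type*} [∀ j, Group (M j)]
    (hM : ∀ j, ResiduallyFinite (M j)) (l : List (Σ j, M j)) (hne : ∀ a ∈ l, a.2 ≠ 1)
    (hchain : l.IsChain fun a b => a.1 ≠ b.1) :
    ∃ (Ω : Type) (_ : Finite Ω) (τ : ∀ j, M j →* Equiv.Perm Ω) (ω : Ω),
      (∀ j, (∀ a ∈ l.head?, a.1 ≠ j) → ∀ m, τ j m (actList τ l ω) = actList τ l ω) ∧
      ∀ l', l' <:+ l → l' ≠ l → actList τ l' ω ≠ actList τ l ω := by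
  classical
  induction l with
  | nil =>
    refine ⟨Unit, inferInstance, fun _ => 1, (), fun _ _ _ => rfl, fun l' h h' => ?_⟩
    exact absurd (List.suffix_nil.1 h) h'
  | cons a l ih =>
    obtain ⟨i, m⟩ := a
    obtain ⟨Ω, _, τ, ω, hfix, hsuf⟩ := ih (fun a ha => hne a (List.mem_cons_of_mem _ ha))
      (List.isChain_cons.1 hchain).2
    obtain ⟨Q, _, _, q, hq⟩ := hM i m (hne _ List.mem_cons_self)
    have hfixi : ∀ m, τ i m (actList τ l ω) = actList τ l ω :=
      hfix i fun b hb => ((List.isChain_cons.1 hchain).1 b hb).symm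
    set e := actList τ l ω with he
    let s : Equiv.Perm (Ω ⊕ Q) := Equiv.swap (Sum.inl e) (Sum.inr 1)
    let base : ∀ j, M j →* Equiv.Perm (Ω ⊕ Q) := fun j =>
      (Equiv.Perm.sumCongrHom Ω Q).comp ((τ j).prod 1)
    let new : M i →* Equiv.Perm (Ω ⊕ Q) :=
      (MulAut.conj s).toMonoidHom.comp ((Equiv.Perm.sumCongrHom Ω Q).comp
        ((τ i).prod ((MulAction.toPermHom Q Q).comp q)))
    let τ' := Function.update base i new
    have hbase : ∀ j, j ≠ i → ∀ m, τ' j m = Equiv.sumCongr (τ j m) 1 := by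
      intro j hj m
      simp only [τ', Function.update_of_ne hj]
      rfl
    have hnew : ∀ m x, τ' i m x = s (Equiv.sumCongr (τ i m) (MulAction.toPerm (q m)) (s x)) := by
      intro m x
      simp only [τ', Function.update_self, new]
      have : s⁻¹ = s := Equiv.swap_inv _ _
      simp [Equiv.Perm.mul_apply, this]
    have hs : ∀ p, p ≠ e → s (Sum.inl p) = Sum.inl p := fun p hp =>
      Equiv.swap_apply_of_ne_of_ne (by simpa using hp) (by simp)
    have hstep : ∀ j n p, p ≠ e → τ' j n (Sum.inl p) = Sum.inl (τ j n p) := by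
      intro j n p hp
      by_cases hj : j = i
      · subst hj
        have h2 : τ j n p ≠ e := fun h => hp ((τ j n).injective (h.trans (hfixi n).symm))
        rw [hnew, hs p hp]
        exact hs _ h2
      · rw [hbase j hj]; rfl
    have hpath : ∀ l', l' <:+ l → actList τ' l' (Sum.inl ω) = Sum.inl (actList τ l' ω) := by
      intro l' hl'
      induction l' with
      | nil => rfl
      | cons b t iht =>
        have ht : t <:+ l := (List.suffix_cons b t).trans hl'
        have hne : t ≠ l := by
          rintro rfl
          have := hl'.length_le
          simp at this
        change τ' b.1 b.2 (actList τ' t (Sum.inl ω)) = _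
        rw [iht ht, hstep _ _ _ (hsuf t ht hne)]
        rfl
    have hend : actList τ' (⟨i, m⟩ :: l) (Sum.inl ω) = Sum.inr (q m) := by
      change τ' i m (actList τ' l (Sum.inl ω)) = _
      rw [hpath l List.suffix_rfl, ← he, hnew]
      simp only [s]
      rw [Equiv.swap_apply_left]
      simp only [Equiv.sumCongr_apply, Sum.map_inr, MulAction.toPerm_apply, smul_eq_mul, mul_one]
      rw [Equiv.swap_apply_of_ne_of_ne (by simp) (by simpa using hq)]
    refine ⟨Ω ⊕ Q, inferInstance, τ', Sum.inl ω, ?_, ?_⟩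
    · intro j hj n
      have hj' : j ≠ i := (hj ⟨i, m⟩ (by simp)).symm
      rw [hend, hbase j hj']
      rfl
    · intro l' hl' hne'
      rcases List.suffix_cons_iff.1 hl' with h | h
      · exact absurd h hne'
      · rw [hend, hpath l' h]
        simp

theorem actList_eq_prod {J Ω : Type*} {M : J → Type*} [∀ j, Group (M j)]
    (τ : ∀ j, M j →* Equiv.Perm Ω) (l : List (Σ j, M j)) (ω : Ω) :
    actList τ l ω = (l.map fun a => τ a.1 a.2).prod ω := by
  induction l with
  | nil => rfl
  | cons a l ih => simp [actList, ← ih]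

/-- A nontrivial element of a free product of residually finite groups survives in a finite
quotient; whether it does depends only on finitely many of the factors. -/
theorem exists_finite_lift_ne_one {J : Type*} {M : J → Type*} [∀ j, Group (M j)]
    (hM : ∀ j, ResiduallyFinite (M j)) (w : CoprodI M) (hw : w ≠ 1) :
    ∃ (P : Type) (_ : Group P) (_ : Finite P) (τ : ∀ j, M j →* P) (J₀ : Finset J),
      ∀ τ' : ∀ j, M j →* P, (∀ j ∈ J₀, τ' j = τ j) → CoprodI.lift τ' w ≠ 1 := by
  classical
  obtain ⟨v, rfl⟩ := (CoprodI.Word.equiv (M := M)).symm.surjective w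
  change v.prod ≠ 1 at hw
  obtain ⟨Ω, _, τ, ω, -, h⟩ := exists_actList_ne hM v.toList v.ne_one v.chain_ne
  have hv : [] ≠ v.toList := fun h => hw (by simp [CoprodI.Word.prod, ← h])
  refine ⟨Equiv.Perm Ω, inferInstance, inferInstance, τ, (v.toList.map Sigma.fst).toFinset,
    fun τ' hτ' h1 => h [] (List.nil_suffix) hv ?_⟩
  rw [actList_eq_prod τ v.toList]
  change CoprodI.lift τ' v.prod = 1 at h1
  rw [CoprodI.Word.prod, map_list_prod, List.map_map] at h1
  have : v.toList.map (fun a => τ a.1 a.2) =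
      v.toList.map (CoprodI.lift τ' ∘ fun l => CoprodI.of l.snd) := by
    refine List.map_congr_left fun a ha => ?_
    have : τ' a.1 = τ a.1 := hτ' _ (by simpa using ⟨a.2, ha⟩)
    simp [this]
  rw [this, h1]
  rfl

section EdgeWords
variable {K Z P : Type*} [Group K] [Group P]

/-- The value of a word under an assignment of group elements to its letters. -/
def evalWord {α : Type*} (c : α → P) (l : List (α × Bool)) : P :=
  (l.map fun a => cond a.2 (c a.1) (c a.1)⁻¹).prod

theorem evalWord_append {α : Type*} (c : α → P) (l l' : List (α × Bool)) :
    evalWord c (l ++ l') = evalWord c l * evalWord c l' := by simp [evalWord]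

theorem evalWord_cons {α : Type*} (c : α → P) (a : α × Bool) (l : List (α × Bool)) :
    evalWord c (a :: l) = cond a.2 (c a.1) (c a.1)⁻¹ * evalWord c l := by simp [evalWord]

theorem evalWord_congr {α : Type*} {c c' : α → P} {l : List (α × Bool)}
    (h : ∀ a ∈ l, c a.1 = c' a.1) : evalWord c l = evalWord c' l := by
  unfold evalWord
  congr 1
  exact List.map_congr_left fun a ha => by rw [h a ha]

theorem map_evalWord {α P' : Type*} [Group P'] (ρ : P →* P') (c : α → P) (l : List (α × Bool)) :
    ρ (evalWord c l) = evalWord (fun a => ρ (c a)) l := by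
  induction l with
  | nil => simp [evalWord]
  | cons a l ih =>
    obtain ⟨a, _ | _⟩ := a <;> simp [evalWord_cons, ih]

theorem lift_mk_eq_evalWord {α : Type*} (c : α → P) (l : List (α × Bool)) :
    FreeGroup.lift c (FreeGroup.mk l) = evalWord c l := FreeGroup.lift_mk

/-- The weight of a signed letter. -/
def letterWt (θ : Z → ℤ) (a : Z × Bool) : ℤ := if a.2 then θ a.1 else -θ a.1

/-- The path traced by a word starting at height `h`: the letter `x` is replaced by the edge
`(x, i)`, leading from height `i` to height `i + θ x`, which it traverses. -/
def edgeWord (θ : Z → ℤ) : ℤ → List (Z × Bool) → List ((Z × ℤ) × Bool)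
  | _, [] => []
  | h, a :: W => ((a.1, if a.2 then h else h - θ a.1), a.2) :: edgeWord θ (h + letterWt θ a) W

/-- The total weight of a word. -/
def wordWt (θ : Z → ℤ) (W : List (Z × Bool)) : ℤ := (W.map (letterWt θ)).sum

theorem edgeWord_append (θ : Z → ℤ) (h : ℤ) (W W' : List (Z × Bool)) :
    edgeWord θ h (W ++ W') = edgeWord θ h W ++ edgeWord θ (h + wordWt θ W) W' := by
  induction W generalizing h with
  | nil => simp [edgeWord, wordWt]
  | cons a W ih => simp [edgeWord, wordWt, ih, add_assoc]

theorem edgeWord_eq_map (θ : Z → ℤ) (h h' : ℤ) (W : List (Z × Bool)) :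
    edgeWord θ (h + h') W = (edgeWord θ h W).map fun e => ((e.1.1, e.1.2 + h'), e.2) := by
  induction W generalizing h with
  | nil => rfl
  | cons a W ih =>
    obtain ⟨a, _ | _⟩ := a
    · simp [edgeWord, letterWt, ← ih]
      exact ⟨by ring, by ring_nf⟩
    · simp [edgeWord, letterWt, ← ih]
      ring_nf

theorem evalWord_edgeWord (θ : Z → ℤ) (c : Z × ℤ → P) (h : ℤ) (W : List (Z × Bool)) :
    evalWord c (edgeWord θ h W) = evalWord (fun e => c (e.1, e.2 + h)) (edgeWord θ 0 W) := by
  conv_lhs => rw [← zero_add h, edgeWord_eq_map]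
  simp [evalWord, List.map_map, Function.comp_def]

theorem evalWord_fst_edgeWord (θ : Z → ℤ) (c : Z → P) (h : ℤ) (W : List (Z × Bool)) :
    evalWord (fun e => c e.1) (edgeWord θ h W) = evalWord c W := by
  induction W generalizing h with
  | nil => rfl
  | cons a W ih => rw [edgeWord, evalWord_cons, evalWord_cons, ih]

variable (z : K) (R : List (Z × Bool))

/-- The group obtained from `K ∗ F(Z)` by identifying the word `R` with `z ∈ K`. -/
def pushGroup : Type _ :=
  Coprod K (FreeGroup Z) ⧸
    Subgroup.normalClosure {(Coprod.inr (FreeGroup.mk R) * (Coprod.inl z)⁻¹ : Coprod K (FreeGroup Z))}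

instance : Group (pushGroup z R) := QuotientGroup.Quotient.group _

/-- The natural homomorphism from `K`. -/
def pushBase : K →* pushGroup z R := (QuotientGroup.mk' _).comp Coprod.inl

/-- The letters as elements of `pushGroup`. -/
def pushLetter (x : Z) : pushGroup z R := QuotientGroup.mk' _ (Coprod.inr (FreeGroup.of x))

theorem evalWord_pushLetter : evalWord (pushLetter z R) R = pushBase z R z := by
  have h : FreeGroup.lift (pushLetter z R) = (QuotientGroup.mk' _).comp Coprod.inr :=
    FreeGroup.ext_hom _ _ fun _ => FreeGroup.lift_apply_of
  rw [← lift_mk_eq_evalWord, h]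
  refine (mul_inv_eq_one (G := pushGroup z R)).1 ?_
  exact (QuotientGroup.eq_one_iff (_ : Coprod K (FreeGroup Z))).2
    (Subgroup.subset_normalClosure rfl)

variable {z R} in
/-- The universal property of `pushGroup`. -/
def pushLift (κ : K →* P) (c : Z → P) (h : evalWord c R = κ z) : pushGroup z R →* P :=
  QuotientGroup.lift _ (Coprod.lift κ (FreeGroup.lift c)) <| by
    refine Subgroup.normalClosure_le_normal (N := (Coprod.lift κ (FreeGroup.lift c)).ker) ?_
    rintro _ rfl
    simp only [SetLike.mem_coe, MonoidHom.mem_ker, map_mul, map_inv, Coprod.lift_apply_inl,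
      Coprod.lift_apply_inr, lift_mk_eq_evalWord, h, mul_inv_cancel]

theorem pushLift_pushBase (κ : K →* P) (c : Z → P) (h : evalWord c R = κ z) (k : K) :
    pushLift κ c h (pushBase z R k) = κ k := rfl

theorem pushLift_pushLetter (κ : K →* P) (c : Z → P) (h : evalWord c R = κ z) (x : Z) :
    pushLift κ c h (pushLetter z R x) = c x := by
  change FreeGroup.lift c (FreeGroup.of x) = c x
  simp

variable {z R} in
theorem push_induction {motive : pushGroup z R → Prop} (g : pushGroup z R)
    (base : ∀ k, motive (pushBase z R k)) (letter : ∀ x, motive (pushLetter z R x))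
    (mul : ∀ a b, motive a → motive b → motive (a * b))
    (inv : ∀ a, motive a → motive a⁻¹) : motive g := by
  obtain ⟨g, rfl⟩ := QuotientGroup.mk'_surjective _ g
  induction g using Coprod.induction_on with
  | inl k => exact base k
  | inr n =>
    induction n using FreeGroup.induction_on with
    | C1 =>
      have h := base 1
      rw [map_one] at h
      rw [map_one, map_one]
      exact h
    | of x => exact letter x
    | inv_of x hx => exact inv _ hx
    | mul a b ha hb =>
      rw [map_mul, map_mul]
      exact mul _ _ ha hb
  | mul a b ha hb =>
    rw [map_mul]
    exact mul _ _ ha hb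

variable (θ : Z → ℤ)

/-- The group generated by a copy of `K` at every height and by all edges, where the path of `R`
starting at height `h` is identified with `z` in the copy of `K` at height `h`. -/
def edgeGroup : Type _ :=
  Coprod (CoprodI fun _ : ℤ => K) (FreeGroup (Z × ℤ)) ⧸
    Subgroup.normalClosure (Set.range fun h : ℤ =>
      (Coprod.inr (FreeGroup.mk (edgeWord θ h R)) *
        (Coprod.inl (CoprodI.of (M := fun _ : ℤ => K) (i := h) z))⁻¹ :
          Coprod (CoprodI fun _ : ℤ => K) (FreeGroup (Z × ℤ))))

instance : Group (edgeGroup z R θ) := QuotientGroup.Quotient.group _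

/-- The copy of `K` at height `i`. -/
def edgeBase (i : ℤ) : K →* edgeGroup z R θ :=
  (QuotientGroup.mk' _).comp (Coprod.inl.comp (CoprodI.of (M := fun _ : ℤ => K) (i := i)))

/-- The edges as elements of `edgeGroup`. -/
def edgeLetter (x : Z) (i : ℤ) : edgeGroup z R θ :=
  QuotientGroup.mk' _ (Coprod.inr (FreeGroup.of (x, i)))

theorem evalWord_edgeLetter (h : ℤ) :
    evalWord (fun e => edgeLetter z R θ e.1 e.2) (edgeWord θ h R) = edgeBase z R θ h z := by
  have h' : FreeGroup.lift (fun e : Z × ℤ => edgeLetter z R θ e.1 e.2) =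
      (QuotientGroup.mk' _).comp Coprod.inr :=
    FreeGroup.ext_hom _ _ fun _ => FreeGroup.lift_apply_of
  rw [← lift_mk_eq_evalWord, h']
  refine (mul_inv_eq_one (G := edgeGroup z R θ)).1 ?_
  exact (QuotientGroup.eq_one_iff (_ : Coprod (CoprodI fun _ : ℤ => K) (FreeGroup (Z × ℤ)))).2
    (Subgroup.subset_normalClosure ⟨h, rfl⟩)

variable {z R θ} in
/-- The universal property of `edgeGroup`. -/
def edgeLift (σ : ℤ → K →* P) (c : Z → ℤ → P)
    (hc : ∀ h, evalWord (fun e => c e.1 e.2) (edgeWord θ h R) = σ h z) : edgeGroup z R θ →* P :=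
  QuotientGroup.lift _ (Coprod.lift (CoprodI.lift σ) (FreeGroup.lift fun e => c e.1 e.2)) <| by
    refine Subgroup.normalClosure_le_normal
      (N := (Coprod.lift (CoprodI.lift σ) (FreeGroup.lift fun e : Z × ℤ => c e.1 e.2)).ker) ?_
    rintro _ ⟨h, rfl⟩
    simp only [SetLike.mem_coe, MonoidHom.mem_ker, map_mul, map_inv, Coprod.lift_apply_inl,
      Coprod.lift_apply_inr, lift_mk_eq_evalWord, hc, CoprodI.lift_of, mul_inv_cancel]

theorem edgeLift_edgeBase (σ : ℤ → K →* P) (c : Z → ℤ → P)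
    (hc : ∀ h, evalWord (fun e => c e.1 e.2) (edgeWord θ h R) = σ h z) (i : ℤ) (k : K) :
    edgeLift σ c hc (edgeBase z R θ i k) = σ i k := by
  change CoprodI.lift σ (CoprodI.of (M := fun _ : ℤ => K) (i := i) k) = σ i k
  simp

theorem edgeLift_edgeLetter (σ : ℤ → K →* P) (c : Z → ℤ → P)
    (hc : ∀ h, evalWord (fun e => c e.1 e.2) (edgeWord θ h R) = σ h z) (x : Z) (i : ℤ) :
    edgeLift σ c hc (edgeLetter z R θ x i) = c x i := by
  change FreeGroup.lift (fun e : Z × ℤ => c e.1 e.2) (FreeGroup.of (x, i)) = c x i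
  simp

variable {z R θ} in
theorem edgeGroup_subgroup_eq_top (S : Subgroup (edgeGroup z R θ))
    (base : ∀ i k, edgeBase z R θ i k ∈ S) (letter : ∀ x i, edgeLetter z R θ x i ∈ S) :
    S = ⊤ := by
  rw [eq_top_iff]
  rintro g -
  obtain ⟨g, rfl⟩ := QuotientGroup.mk'_surjective _ g
  induction g using Coprod.induction_on with
  | inl k =>
    induction k using CoprodI.induction_on with
    | one =>
      rw [map_one, map_one]
      exact S.one_mem
    | of i k => exact base i k
    | mul a b ha hb =>
      rw [map_mul, map_mul]
      exact mul_mem ha hb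
  | inr n =>
    induction n using FreeGroup.induction_on with
    | C1 =>
      rw [map_one, map_one]
      exact S.one_mem
    | of x => exact letter x.1 x.2
    | inv_of x hx => exact inv_mem hx
    | mul a b ha hb =>
      rw [map_mul, map_mul]
      exact mul_mem ha hb
  | mul a b ha hb =>
    rw [map_mul]
    exact mul_mem ha hb

/-- Data, indexed by heights in a quotient `I` of `ℤ`, defining an action of `pushGroup z R` on
`I × P`: homomorphisms `σ i : K →* P` and labels `c x i` of the edges satisfying the relations
of `edgeGroup`. -/
structure HeightRep (I P : Type*) [AddCommGroup I] [Group P] where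
  /-- The quotient map on heights. -/
  ι : ℤ →+ I
  surj : Function.Surjective ι
  /-- The action of the copies of `K`. -/
  σ : I → K →* P
  /-- The edge labels. -/
  c : Z → I → P
  rel : ∀ h, evalWord (fun e : Z × ℤ => c e.1 (ι e.2)) (edgeWord θ h R) = σ (ι h) z

namespace HeightRep
variable {z R θ} {I : Type*} [AddCommGroup I] (s : HeightRep z R θ I P)

/-- The action of `K`. -/
def basePerm : K →* Equiv.Perm (I × P) where
  toFun k :=
    { toFun := fun q => (q.1, s.σ q.1 k * q.2)
      invFun := fun q => (q.1, (s.σ q.1 k)⁻¹ * q.2)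
      left_inv := fun q => by simp
      right_inv := fun q => by simp }
  map_one' := by ext q <;> simp
  map_mul' a b := by ext q <;> simp [mul_assoc]

/-- The action of a letter. -/
def letterPerm (x : Z) : Equiv.Perm (I × P) where
  toFun q := (q.1 - s.ι (θ x), s.c x (q.1 - s.ι (θ x)) * q.2)
  invFun q := (q.1 + s.ι (θ x), (s.c x q.1)⁻¹ * q.2)
  left_inv q := by simp
  right_inv q := by simp

theorem evalWord_letterPerm (W : List (Z × Bool)) (h : ℤ) (q : P) :
    evalWord s.letterPerm W (s.ι (h + wordWt θ W), q) =
      (s.ι h, evalWord (fun e : Z × ℤ => s.c e.1 (s.ι e.2)) (edgeWord θ h W) * q) := by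
  induction W generalizing h with
  | nil => simp [evalWord, edgeWord, wordWt]
  | cons a W ih =>
    have hw : h + wordWt θ (a :: W) = (h + letterWt θ a) + wordWt θ W := by
      simp [wordWt, add_assoc]
    rw [evalWord_cons, Equiv.Perm.mul_apply, hw, ih, edgeWord, evalWord_cons]
    obtain ⟨x, _ | _⟩ := a
    · simp [letterWt, letterPerm, Equiv.Perm.inv_def, mul_assoc, sub_eq_add_neg]
    · simp [letterWt, letterPerm, mul_assoc]

/-- The action of `pushGroup z R` on `I × P`. -/
def toPerm (hR : wordWt θ R = 0) : pushGroup z R →* Equiv.Perm (I × P) :=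
  pushLift s.basePerm s.letterPerm <| by
    ext1 ⟨i, q⟩
    obtain ⟨h, rfl⟩ := s.surj i
    have := s.evalWord_letterPerm R h q
    rw [hR, add_zero, s.rel] at this
    exact this

/-- Compatible maps of heights and values intertwine the actions. -/
theorem toPerm_map (hR : wordWt θ R = 0) {P' I' : Type*} [Group P'] [AddCommGroup I']
    (s' : HeightRep z R θ I' P') (φ : I →+ I') (ρ : P →* P')
    (hι : ∀ h, φ (s.ι h) = s'.ι h) (hσ : ∀ i k, ρ (s.σ i k) = s'.σ (φ i) k)
    (hc : ∀ x i, ρ (s.c x i) = s'.c x (φ i)) (g : pushGroup z R) (q : I × P) :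
    s'.toPerm hR g (φ q.1, ρ q.2) = (φ (s.toPerm hR g q).1, ρ (s.toPerm hR g q).2) := by
  induction g using push_induction generalizing q with
  | base k =>
    simp only [toPerm, pushLift_pushBase]
    simp [basePerm, hσ]
  | letter x =>
    simp only [toPerm, pushLift_pushLetter]
    simp [letterPerm, hc, hι]
  | mul a b ha hb =>
    simp only [map_mul, Equiv.Perm.mul_apply]
    rw [hb, ha]
  | inv a ha =>
    rw [map_inv, map_inv, Equiv.Perm.inv_eq_iff_eq, ha]
    simp

end HeightRep
end EdgeWords

section Recursion
variable {P : Type*}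

/-- One-sided recursion: relations that can be solved for their last entry have a common solution
with prescribed values at negative arguments. -/
theorem exists_forward_solution (Rel : ℕ → (ℤ → P) → Prop)
    (loc : ∀ (n : ℕ) v v', (∀ j : ℤ, j ≤ n → v j = v' j) → Rel n v → Rel n v')
    (fwd : ∀ (n : ℕ) v, ∃ y, Rel n (Function.update v n y)) (v₀ : ℤ → P) :
    ∃ v : ℤ → P, (∀ j < 0, v j = v₀ j) ∧ ∀ n, Rel n v := by
  choose F hF using fwd
  let u : ℕ → ℤ → P := fun n => Nat.rec v₀ (fun n w => Function.update w n (F n w)) n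
  have hu : ∀ n, u (n + 1) = Function.update (u n) n (F n (u n)) := fun _ => rfl
  have hstab : ∀ (m n : ℕ) (j : ℤ), j < m → m ≤ n → u n j = u m j := by
    intro m n j hj hmn
    induction n, hmn using Nat.le_induction with
    | base => rfl
    | succ n hn ih => rw [hu, Function.update_of_ne (by lia), ih]
  refine ⟨fun j => u (j.toNat + 1) j, fun j hj => ?_, fun n => ?_⟩
  · exact hstab 0 (j.toNat + 1) j (by simpa using hj) (by simp)
  · refine loc n (u (n + 1)) _ (fun j hj => ?_) (by rw [hu]; exact hF _ _)
    exact hstab (j.toNat + 1) (n + 1) j (by lia) (by lia)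

/-- Periodic relations on a window of length `L + 1` in a sequence with values in a finite set,
which can be solved for the last entry and determine the first entry, have a periodic solution
with prescribed values on a window of length `L`. -/
theorem exists_periodic_solution [Finite P] (L : ℕ) (hL : 0 < L) (per : ℕ) [NeZero per]
    (Rel : ZMod per → (ℤ → P) → Prop)
    (loc : ∀ r v v', (∀ j : ℤ, 0 ≤ j → j ≤ L → v j = v' j) → Rel r v → Rel r v')
    (fwd : ∀ r v, ∃ y, Rel r (Function.update v L y))
    (bwd : ∀ r v v', (∀ j : ℤ, 0 < j → j ≤ L → v j = v' j) → Rel r v → Rel r v' → v 0 = v' 0)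
    (u₀ : ℤ → P) :
    ∃ D : ℕ, 0 < D ∧ per ∣ D ∧ ∃ b : ZMod D → P,
      (∀ j : ℤ, 0 ≤ j → j < L → b j = u₀ j) ∧ ∀ i : ℤ, Rel i fun j => b ((i + j : ℤ) : ZMod D) := by
  let ext : (Fin L → P) → P → ℤ → P := fun u y j =>
    if h : 0 ≤ j ∧ j < L then u ⟨j.toNat, by omega⟩ else y
  have ext_lt : ∀ u y (k : Fin L), ext u y k = u k := fun u y k => by simp [ext]
  have ext_L : ∀ u y, ext u y L = y := fun u y => by simp [ext]
  have hY : ∀ r u, ∃ y, Rel r (ext u y) := by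
    intro r u
    obtain ⟨y, hy⟩ := fwd r (ext u (u ⟨0, hL⟩))
    refine ⟨y, loc _ _ _ (fun j h0 hj => ?_) hy⟩
    rcases hj.eq_or_lt with rfl | hj
    · rw [Function.update_self, ext_L]
    · rw [Function.update_of_ne hj.ne]
      simp [ext, h0, hj]
  choose Y hY using hY
  let T : ZMod per × (Fin L → P) → ZMod per × (Fin L → P) := fun s =>
    (s.1 + 1, fun k => ext s.2 (Y s.1 s.2) (k + 1))
  have hT : Function.Injective T := by
    rintro ⟨r, u⟩ ⟨r', u'⟩ h
    simp only [T, Prod.mk.injEq, add_left_inj] at h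
    obtain ⟨rfl, h⟩ := h
    have hpos : ∀ j : ℤ, 0 < j → j ≤ L → ext u (Y r u) j = ext u' (Y r u') j := by
      intro j h0 hj
      have := congrFun h ⟨(j - 1).toNat, by omega⟩
      have e : (((j - 1).toNat : ℕ) : ℤ) + 1 = j := by omega
      change ext u (Y r u) ((((j - 1).toNat : ℕ) : ℤ) + 1) =
        ext u' (Y r u') ((((j - 1).toNat : ℕ) : ℤ) + 1) at this
      rwa [e] at this
    have h0 := bwd r _ _ hpos (hY r u) (hY r u')
    refine Prod.ext rfl (funext fun k => ?_)
    change u k = u' k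
    rw [← ext_lt u (Y r u), ← ext_lt u' (Y r u')]
    rcases Nat.eq_zero_or_pos k.1 with hk | hk
    · simpa [hk] using h0
    · exact hpos _ (by omega) (by have := k.2; omega)
  let Tp : Equiv.Perm (ZMod per × (Fin L → P)) :=
    Equiv.ofBijective T (Finite.injective_iff_bijective.1 hT)
  let s : ℤ → ZMod per × (Fin L → P) := fun i => (Tp ^ i) (0, fun k => u₀ k)
  have hs : ∀ i, s (i + 1) = T (s i) := by
    intro i
    simp only [s, add_comm i 1, zpow_add, zpow_one, Equiv.Perm.mul_apply]
    rfl
  have hs1 : ∀ i : ℤ, (s i).1 = i := by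
    intro i
    induction i with
    | zero => simp [s]
    | succ i ih => rw [hs]; simp [T, ih]
    | pred i ih =>
      have := congrArg Prod.fst (hs (-i - 1))
      rw [sub_add_cancel, ih] at this
      change _ = (s (-i - 1)).1 + 1 at this
      rw [← sub_eq_iff_eq_add] at this
      rw [← this]
      push_cast
      rfl
  have hs2 : ∀ (k : ℕ) (hk : k < L) (i : ℤ), (s i).2 ⟨k, hk⟩ = (s (i + k)).2 ⟨0, hL⟩ := by
    intro k
    induction k with
    | zero => simp
    | succ k ih =>
      intro hk i
      have := ih (by omega) (i + 1)
      rw [hs] at this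
      have h2 := ext_lt (s i).2 (Y (s i).1 (s i).2) ⟨k + 1, hk⟩
      push_cast at h2
      simp only [T, h2] at this
      have e : i + 1 + (k : ℤ) = i + ((k + 1 : ℕ) : ℤ) := by omega
      rw [this, e]
  have hD : 0 < orderOf Tp := orderOf_pos Tp
  have : NeZero (orderOf Tp) := ⟨hD.ne'⟩
  let b : ZMod (orderOf Tp) → P := fun r => (s r.val).2 ⟨0, hL⟩
  have hb : ∀ i : ℤ, b i = (s i).2 ⟨0, hL⟩ := by
    intro i
    simp only [b, ZMod.val_intCast, s, zpow_mod_orderOf]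
  refine ⟨orderOf Tp, hD, ?_, b, fun j h0 hj => ?_, fun i => ?_⟩
  · rw [← ZMod.natCast_eq_zero_iff]
    have := hs1 (orderOf Tp)
    simpa [s, pow_orderOf_eq_one] using this.symm
  · lift j to ℕ using h0
    rw [hb, ← zero_add (j : ℤ), ← hs2 j (by omega)]
    simp [s]
  · refine loc _ _ _ (fun j h0 hj => ?_) (hs1 i ▸ hY (s i).1 (s i).2)
    rw [hb]
    lift j to ℕ using h0
    rcases (Nat.cast_le.1 hj).eq_or_lt with rfl | hj
    · rw [ext_L]
      have := hs2 (j - 1) (by omega) (i + 1)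
      have e : i + 1 + ((j - 1 : ℕ) : ℤ) = i + j := by omega
      rw [e, hs] at this
      rw [← this]
      have e' : ((j - 1 : ℕ) : ℤ) + 1 = j := by omega
      simp [T, e', ext_L, hs1]
    · rw [← hs2 j hj, ← ext_lt (s i).2 _ ⟨j, hj⟩]

end Recursion

section UniqueOccurrence
variable {α P : Type*} [Group P]

/-- The letter `a` occurs exactly once in the word `e`. -/
def OccursOnce (e : List (α × Bool)) (a : α) : Prop :=
  ∃ A B ε, e = A ++ (a, ε) :: B ∧ ∀ b ∈ A ++ B, b.1 ≠ a

theorem OccursOnce.exists_update [DecidableEq α] {e : List (α × Bool)} {a : α}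
    (h : OccursOnce e a) (c : α → P) (t : P) :
    ∃ y, evalWord (Function.update c a y) e = t := by
  obtain ⟨A, B, ε, rfl, h⟩ := h
  have hA : ∀ y, evalWord (Function.update c a y) A = evalWord c A := fun y =>
    evalWord_congr fun b hb => Function.update_of_ne (h b (by simp [hb])) _ _
  have hB : ∀ y, evalWord (Function.update c a y) B = evalWord c B := fun y =>
    evalWord_congr fun b hb => Function.update_of_ne (h b (by simp [hb])) _ _
  simp only [evalWord_append, evalWord_cons, hA, hB, Function.update_self]
  cases ε
  · exact ⟨((evalWord c A)⁻¹ * t * (evalWord c B)⁻¹)⁻¹, by simp [mul_assoc]⟩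
  · exact ⟨(evalWord c A)⁻¹ * t * (evalWord c B)⁻¹, by simp [mul_assoc]⟩

theorem OccursOnce.eq_of_evalWord_eq {e : List (α × Bool)} {a : α} (h : OccursOnce e a)
    {c c' : α → P} (hc : ∀ b ∈ e, b.1 ≠ a → c b.1 = c' b.1)
    (he : evalWord c e = evalWord c' e) : c a = c' a := by
  obtain ⟨A, B, ε, rfl, h⟩ := h
  have hA : evalWord c A = evalWord c' A :=
    evalWord_congr fun b hb => hc b (by simp [hb]) (h b (by simp [hb]))
  have hB : evalWord c B = evalWord c' B :=
    evalWord_congr fun b hb => hc b (by simp [hb]) (h b (by simp [hb]))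
  simp only [evalWord_append, evalWord_cons, hA, hB] at he
  cases ε <;> simpa using he

theorem evalWord_mem {S : Subgroup P} {e : List (α × Bool)} {c : α → P}
    (h : ∀ b ∈ e, c b.1 ∈ S) : evalWord c e ∈ S := by
  refine S.list_prod_mem fun x hx => ?_
  obtain ⟨⟨b, ε⟩, hb, rfl⟩ := List.mem_map.1 hx
  cases ε
  · exact S.inv_mem (h _ hb)
  · exact h _ hb

theorem OccursOnce.mem_of_evalWord_mem {e : List (α × Bool)} {a : α} (h : OccursOnce e a)
    {S : Subgroup P} {c : α → P} (hc : ∀ b ∈ e, b.1 ≠ a → c b.1 ∈ S)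
    (he : evalWord c e ∈ S) : c a ∈ S := by
  obtain ⟨A, B, ε, rfl, h⟩ := h
  have hA : evalWord c A ∈ S :=
    evalWord_mem fun b hb => hc b (by simp [hb]) (h b (by simp [hb]))
  have hB : evalWord c B ∈ S :=
    evalWord_mem fun b hb => hc b (by simp [hb]) (h b (by simp [hb]))
  rw [evalWord_append, evalWord_cons, S.mul_mem_cancel_left hA, S.mul_mem_cancel_right hB] at he
  cases ε
  · exact S.inv_mem_iff.1 he
  · exact he

end UniqueOccurrence

section Extremes
variable {Z : Type*}

/-- The edge `(p, i)` is traversed once by the path `e`, and is the highest of the edges labelled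
`p` in `e`. -/
def IsUniqueMax (e : List ((Z × ℤ) × Bool)) (p : Z) (i : ℤ) : Prop :=
  ∃ A B ε, e = A ++ ((p, i), ε) :: B ∧ ∀ b ∈ A ++ B, b.1.1 = p → b.1.2 < i

/-- The edge `(p, i)` is traversed once by the path `e`, and is the lowest of the edges labelled
`p` in `e`. -/
def IsUniqueMin (e : List ((Z × ℤ) × Bool)) (p : Z) (i : ℤ) : Prop :=
  ∃ A B ε, e = A ++ ((p, i), ε) :: B ∧ ∀ b ∈ A ++ B, b.1.1 = p → i < b.1.2

theorem IsUniqueMax.once {e : List ((Z × ℤ) × Bool)} {p : Z} {i : ℤ} (h : IsUniqueMax e p i) :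
    OccursOnce e (p, i) := by
  obtain ⟨A, B, ε, rfl, h⟩ := h
  exact ⟨A, B, ε, rfl, fun b hb hbp => by simpa [hbp] using h b hb⟩

theorem IsUniqueMax.le {e : List ((Z × ℤ) × Bool)} {p : Z} {i : ℤ} (h : IsUniqueMax e p i) :
    ∀ b ∈ e, b.1.1 = p → b.1.2 ≤ i := by
  obtain ⟨A, B, ε, rfl, h⟩ := h
  intro b hb hbp
  rw [List.mem_append, List.mem_cons, or_left_comm, ← List.mem_append] at hb
  rcases hb with rfl | hb
  · exact le_rfl
  · exact (h b hb hbp).le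

theorem IsUniqueMin.once {e : List ((Z × ℤ) × Bool)} {p : Z} {i : ℤ} (h : IsUniqueMin e p i) :
    OccursOnce e (p, i) := by
  obtain ⟨A, B, ε, rfl, h⟩ := h
  exact ⟨A, B, ε, rfl, fun b hb hbp => by simpa [hbp] using h b hb⟩

theorem IsUniqueMin.le {e : List ((Z × ℤ) × Bool)} {p : Z} {i : ℤ} (h : IsUniqueMin e p i) :
    ∀ b ∈ e, b.1.1 = p → i ≤ b.1.2 := by
  obtain ⟨A, B, ε, rfl, h⟩ := h
  intro b hb hbp
  rw [List.mem_append, List.mem_cons, or_left_comm, ← List.mem_append] at hb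
  rcases hb with rfl | hb
  · exact le_rfl
  · exact (h b hb hbp).le

variable {K : Type*} [Group K] {z : K} {R : List (Z × Bool)} {θ : Z → ℤ} {p m : Z} {ip im : ℤ}

theorem pushBase_injective (hR : wordWt θ R = 0) (hp : IsUniqueMax (edgeWord θ 0 R) p ip) :
    Function.Injective (pushBase z R) := by
  classical
  let σ : ℤ → K →* K := fun i => if i = 0 then MonoidHom.id K else 1
  let lab : (ℤ → K) → Z → ℤ → K := fun v x i => if x = p then v (i - ip) else 1
  obtain ⟨v, hv0, hv⟩ := exists_forward_solution
    (fun n v => evalWord (fun e : Z × ℤ => lab v e.1 (e.2 + n)) (edgeWord θ 0 R) = σ n z)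
    (fun n v v' h hv => by
      rw [← hv]
      refine evalWord_congr fun b hb => ?_
      by_cases hbp : b.1.1 = p
      · simp only [lab, hbp, if_true]
        exact (h _ (by have := hp.le b hb hbp; lia)).symm
      · simp [lab, hbp])
    (fun n v => by
      obtain ⟨y, hy⟩ := hp.once.exists_update (fun e : Z × ℤ => lab v e.1 (e.2 + n)) (σ n z)
      refine ⟨y, hy ▸ congrArg (evalWord · _) (funext fun e => ?_)⟩
      obtain ⟨x, i⟩ := e
      simp only [lab, Function.update_apply, Prod.mk.injEq]
      by_cases hx : x = p
      · by_cases hi : i = ip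
        · simp [hx, hi]
        · have : i + n - ip ≠ n := by lia
          simp [hx, hi, this]
      · simp [hx])
    (fun _ => 1)
  let s : HeightRep z R θ ℤ K :=
    { ι := AddMonoidHom.id ℤ
      surj := Function.surjective_id
      σ := σ
      c := lab v
      rel := fun h => by
        rw [evalWord_edgeWord]
        by_cases hh : 0 ≤ h
        · lift h to ℕ using hh
          exact hv h
        · have h1 : evalWord (fun e : Z × ℤ => lab v e.1 (AddMonoidHom.id ℤ (e.2 + h)))
              (edgeWord θ 0 R) = evalWord (fun _ => (1 : K)) (edgeWord θ 0 R) := by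
            refine evalWord_congr fun b hb => ?_
            by_cases hbp : b.1.1 = p
            · have := hp.le b hb hbp
              simp only [lab, hbp, if_true, AddMonoidHom.id_apply]
              exact hv0 _ (by lia)
            · simp [lab, hbp]
          have h0 : h ≠ 0 := by lia
          refine h1.trans ?_
          simp [σ, h0, evalWord] }
  rw [injective_iff_map_eq_one]
  intro k hk
  have h1 : s.toPerm hR (pushBase z R k) (0, 1) = (0, 1) := by rw [hk]; simp
  have h2 : s.toPerm hR (pushBase z R k) (0, 1) = (0, k) := by
    simp [HeightRep.toPerm, pushLift_pushBase, HeightRep.basePerm, s, σ]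
  simpa using h2.symm.trans h1

/-- The edges which cannot be eliminated by solving for the highest edge `p` or the lowest
edge `m`. -/
def IsFreeEdge (p m : Z) (ip im : ℤ) (e : Z × ℤ) : Prop :=
  (e.1 = p → e.2 < ip) ∧ (e.1 = m → im ≤ e.2)

theorem edgeGroup_subgroup_eq_top_of_free (hpm : p ≠ m)
    (hp : IsUniqueMax (edgeWord θ 0 R) p ip) (hm : IsUniqueMin (edgeWord θ 0 R) m im)
    (S : Subgroup (edgeGroup z R θ)) (base : ∀ i k, edgeBase z R θ i k ∈ S)
    (letter : ∀ e, IsFreeEdge p m ip im e → edgeLetter z R θ e.1 e.2 ∈ S) : S = ⊤ := by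
  have hrel : ∀ h, evalWord (fun e : Z × ℤ => edgeLetter z R θ e.1 (e.2 + h))
      (edgeWord θ 0 R) ∈ S := fun h => by
    have := evalWord_edgeWord θ (fun e => edgeLetter z R θ e.1 e.2) h R
    rw [← this, evalWord_edgeLetter]
    exact base h z
  have hup : ∀ n : ℕ, edgeLetter z R θ p (ip + n) ∈ S := by
    intro n
    induction n using Nat.strong_induction_on with
    | _ n ih =>
      refine hp.once.mem_of_evalWord_mem (fun b hb hne => ?_) (hrel n)
      by_cases hlow : IsFreeEdge p m ip im (b.1.1, b.1.2 + n)
      · exact letter _ hlow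
      · have hbp : b.1.1 = p := by
          by_contra hbp
          exact hlow ⟨fun h => absurd h hbp, fun h => by have := hm.le b hb h; simp only; lia⟩
        have hle := hp.le b hb hbp
        have hlt : b.1.2 ≠ ip := fun h => hne (Prod.ext hbp h)
        have hge : ip ≤ b.1.2 + n := by
          by_contra hlt'
          exact hlow ⟨fun _ => by simp only; lia, fun h => absurd (hbp.symm.trans h) hpm⟩
        have := ih (b.1.2 + n - ip).toNat (by lia)
        rwa [Int.toNat_of_nonneg (by lia), add_sub_cancel, ← hbp] at this
  have hdown : ∀ n : ℕ, edgeLetter z R θ m (im - (n + 1 : ℕ)) ∈ S := by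
    intro n
    induction n using Nat.strong_induction_on with
    | _ n ih =>
      rw [sub_eq_add_neg]
      refine hm.once.mem_of_evalWord_mem (fun b hb hne => ?_) (hrel (-(n + 1 : ℕ)))
      by_cases hlow : IsFreeEdge p m ip im (b.1.1, b.1.2 + -(n + 1 : ℕ))
      · exact letter _ hlow
      · have hbm : b.1.1 = m := by
          by_contra hbm
          exact hlow ⟨fun h => by have := hp.le b hb h; simp only; lia, fun h => absurd h hbm⟩
        have hle := hm.le b hb hbm
        have hlt : b.1.2 ≠ im := fun h => hne (Prod.ext hbm h)
        have hge : b.1.2 + -(n + 1 : ℕ) < im := by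
          by_contra hlt'
          exact hlow ⟨fun h => absurd (h.symm.trans hbm) hpm, fun _ => by simp only; lia⟩
        have := ih (im - 1 - (b.1.2 + -(n + 1 : ℕ))).toNat (by lia)
        have e : im - (((im - 1 - (b.1.2 + -(n + 1 : ℕ))).toNat + 1 : ℕ) : ℤ)
            = b.1.2 + -(n + 1 : ℕ) := by lia
        rwa [e, ← hbm] at this
  refine edgeGroup_subgroup_eq_top S base fun x i => ?_
  by_cases hfree : IsFreeEdge p m ip im (x, i)
  · exact letter _ hfree
  · by_cases hx : x = p
    · have hi : ip ≤ i := by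
        by_contra hi
        exact hfree ⟨fun _ => by simp only; lia, fun h => absurd (hx.symm.trans h) hpm⟩
      have := hup (i - ip).toNat
      rwa [Int.toNat_of_nonneg (by lia), add_sub_cancel, ← hx] at this
    · have hx' : x = m := by
        by_contra hx'
        exact hfree ⟨fun h => absurd h hx, fun h => absurd h hx'⟩
      have hi : i < im := by
        by_contra hi
        exact hfree ⟨fun h => absurd h hx, fun _ => by simp only; lia⟩
      have := hdown (im - 1 - i).toNat
      have e : im - (((im - 1 - i).toNat + 1 : ℕ) : ℤ) = i := by lia
      rwa [e, ← hx'] at this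

end Extremes

section Finite
variable {K Z : Type*} [Group K] {z : K} {R : List (Z × Bool)} {θ : Z → ℤ} {p m : Z} {ip im : ℤ}

theorem ZMod.valMinAbs_intCast_of_abs_le {N : ℕ} {i : ℤ} (hi : |i| ≤ N) :
    (i : ZMod (2 * N + 1)).valMinAbs = i := by
  rw [ZMod.valMinAbs_spec]
  rw [abs_le] at hi
  refine ⟨rfl, ?_, ?_⟩ <;> push_cast <;> linarith

/-- Labels in a finite group, prescribed on the vertices and the free edges at bounded height, can
be modified at large heights to give a periodic solution of the relations of `edgeGroup`. -/
theorem exists_finite_heightRep {P : Type*} [Group P] [Finite P] (hpm : p ≠ m)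
    (hp : IsUniqueMax (edgeWord θ 0 R) p ip) (hm : IsUniqueMin (edgeWord θ 0 R) m im)
    (σ : ℤ → K →* P) (c : Z → ℤ → P) (N₀ : ℕ) :
    ∃ (D : ℕ) (_ : NeZero D) (s : HeightRep z R θ (ZMod D) P), (∀ i, s.ι i = i) ∧
      (∀ i : ℤ, |i| ≤ N₀ → s.σ i = σ i) ∧
      ∀ x (i : ℤ), |i| ≤ N₀ → IsFreeEdge p m ip im (x, i) → s.c x i = c x i := by
  classical
  obtain ⟨N, hN₀, hNp, hNm, hNR⟩ : ∃ N : ℕ, (N₀ : ℤ) ≤ N ∧ |ip| ≤ N ∧ |im| ≤ N ∧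
      ∀ b ∈ edgeWord θ 0 R, |b.1.2| ≤ N := by
    refine ⟨N₀ + ip.natAbs + im.natAbs + ((edgeWord θ 0 R).map fun b => b.1.2.natAbs).sum,
      by lia, by rw [Int.abs_eq_natAbs]; lia, by rw [Int.abs_eq_natAbs]; lia, fun b hb => ?_⟩
    rw [Int.abs_eq_natAbs]
    have := List.le_sum_of_mem (List.mem_map_of_mem (f := fun b => b.1.2.natAbs) hb)
    lia
  rw [abs_le] at hNp hNm
  simp only [abs_le] at hNR
  obtain ⟨L, hL⟩ : ∃ L : ℕ, (L : ℤ) = ip + (2 * N + 1 : ℕ) - im :=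
    ⟨(ip + (2 * N + 1 : ℕ) - im).toNat, by lia⟩
  push_cast at hL
  let σ' : ZMod (2 * N + 1) → K →* P := fun r => σ r.valMinAbs
  let c' : Z → ZMod (2 * N + 1) → P := fun x r => c x r.valMinAbs
  let lab : ZMod (2 * N + 1) → (ℤ → P) → Z × ℤ → P := fun r v e =>
    if e.1 = p then v (e.2 + (2 * N + 1 - im)) else if e.1 = m then v (e.2 - im) else c' e.1 (r + e.2)
  have lab_p : ∀ r v e, e.1 = p → lab r v e = v (e.2 + (2 * N + 1 - im)) := fun r v e h => if_pos h
  have lab_m : ∀ r v e, e.1 = m → lab r v e = v (e.2 - im) := fun r v e h => by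
    simp [lab, h, hpm.symm]
  have lab_o : ∀ r v e, e.1 ≠ p → e.1 ≠ m → lab r v e = c' e.1 (r + e.2) := fun r v e h h' => by
    simp [lab, h, h']
  clear_value lab
  obtain ⟨D, hD, hdvd, b, hb, hrel⟩ := exists_periodic_solution L (by lia) (2 * N + 1)
    (fun r v => evalWord (lab r v) (edgeWord θ 0 R) = σ' r z)
    (fun r v v' h hv => by
      rw [← hv]
      refine evalWord_congr fun e he => ?_
      have hNe := hNR e he
      by_cases h1 : e.1.1 = p
      · have := hp.le e he h1
        rw [lab_p _ _ _ h1, lab_p _ _ _ h1, h _ (by lia) (by lia)]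
      by_cases h2 : e.1.1 = m
      · have := hm.le e he h2
        rw [lab_m _ _ _ h2, lab_m _ _ _ h2, h _ (by lia) (by lia)]
      · rw [lab_o _ _ _ h1 h2, lab_o _ _ _ h1 h2])
    (fun r v => by
      obtain ⟨y, hy⟩ := hp.once.exists_update (lab r v) (σ' r z)
      refine ⟨y, hy ▸ evalWord_congr fun e he => ?_⟩
      have hNe := hNR e he
      rw [Function.update_apply]
      by_cases h1 : e.1.1 = p
      · rw [lab_p _ _ _ h1, lab_p _ _ _ h1, Function.update_apply]
        refine if_congr ?_ rfl rfl
        rw [Prod.ext_iff]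
        simp only [h1, true_and]
        lia
      have h3 : e.1 ≠ (p, ip) := fun h => h1 (congrArg Prod.fst h)
      rw [if_neg h3]
      by_cases h2 : e.1.1 = m
      · rw [lab_m _ _ _ h2, lab_m _ _ _ h2, Function.update_of_ne (by lia)]
      · rw [lab_o _ _ _ h1 h2, lab_o _ _ _ h1 h2])
    (fun r v v' h hv hv' => by
      have := hm.once.eq_of_evalWord_eq (c := lab r v) (c' := lab r v') (fun e he hne => by
        have hNe := hNR e he
        by_cases h1 : e.1.1 = p
        · have := hp.le e he h1
          rw [lab_p _ _ _ h1, lab_p _ _ _ h1, h _ (by lia) (by lia)]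
        by_cases h2 : e.1.1 = m
        · have := hm.le e he h2
          have h3 : e.1.2 ≠ im := fun h => hne (Prod.ext h2 h)
          rw [lab_m _ _ _ h2, lab_m _ _ _ h2, h _ (by lia) (by lia)]
        · rw [lab_o _ _ _ h1 h2, lab_o _ _ _ h1 h2]) (hv.trans hv'.symm)
      rw [lab_m _ _ _ rfl, lab_m _ _ _ rfl] at this
      simpa using this)
    (fun t => if t ≤ N - im then c m (t + im) else c p (t + im - (2 * N + 1)))
  have : NeZero D := ⟨hD.ne'⟩
  let π : ZMod D →+* ZMod (2 * N + 1) := ZMod.castHom hdvd _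
  let s : HeightRep z R θ (ZMod D) P :=
    { ι := Int.castAddHom _
      surj := ZMod.intCast_surjective
      σ := fun r => σ' (π r)
      c := fun x r => if x = p then b (r + ((2 * N + 1 - im : ℤ) : ZMod D)) else
        if x = m then b (r - (im : ZMod D)) else c' x (π r)
      rel := fun h => by
        rw [evalWord_edgeWord]
        have := hrel h
        simp only [Int.coe_castAddHom, map_intCast]
        rw [← this]
        refine evalWord_congr fun e he => ?_
        by_cases h1 : e.1.1 = p
        · rw [lab_p _ _ _ h1, if_pos h1]
          push_cast
          congr 1
          ring
        by_cases h2 : e.1.1 = m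
        · rw [lab_m _ _ _ h2, if_neg h1, if_pos h2]
          push_cast
          congr 1
          ring
        · rw [lab_o _ _ _ h1 h2, if_neg h1, if_neg h2]
          push_cast
          rw [add_comm] }
  refine ⟨D, this, s, fun i => rfl, fun i hi => ?_, fun x i hi hfree => ?_⟩
  · simp only [s, σ', map_intCast, ZMod.valMinAbs_intCast_of_abs_le (hi.trans hN₀)]
  · have hi' := hi.trans hN₀
    rw [abs_le] at hi'
    by_cases h1 : x = p
    · subst h1
      have h2 := hfree.1 rfl
      simp only at h2
      have := hb (i + (2 * N + 1 - im)) (by lia) (by lia)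
      rw [if_neg (by lia)] at this
      simp only [s, if_true]
      rw [← Int.cast_add, this]
      congr 1
      ring
    by_cases h2 : x = m
    · subst h2
      have h3 := hfree.2 rfl
      simp only at h3
      have := hb (i - im) (by lia) (by lia)
      rw [if_pos (by lia), sub_add_cancel] at this
      simp only [s, if_true, if_neg h1]
      rw [← Int.cast_sub, this]
    · simp only [s, if_neg h1, if_neg h2, c', map_intCast,
        ZMod.valMinAbs_intCast_of_abs_le (hi.trans hN₀)]

theorem residuallyFinite_of_injective {G G' : Type*} [Group G] [Group G'] (f : G →* G')
    (hf : Function.Injective f) (h : ResiduallyFinite G') : ResiduallyFinite G := by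
  intro g hg
  obtain ⟨Q, i, j, q, hq⟩ := h (f g) ((map_ne_one_iff f hf).2 hg)
  exact ⟨Q, i, j, q.comp f, hq⟩

theorem residuallyFinite_multiplicative_int : ResiduallyFinite (Multiplicative ℤ) := by
  intro g hg
  refine ⟨Multiplicative (ZMod (g.toAdd.natAbs + 1)), inferInstance, inferInstance,
    AddMonoidHom.toMultiplicative (Int.castAddHom _), fun h => hg ?_⟩
  have h' : ((g.toAdd : ℤ) : ZMod (g.toAdd.natAbs + 1)) = 0 := h
  rw [ZMod.intCast_zmod_eq_zero_iff_dvd] at h'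
  refine Int.eq_zero_of_abs_lt_dvd (x := g.toAdd) h' ?_
  rw [Int.abs_eq_natAbs]
  lia

section Family

/-- A family consisting of copies of `K` and of infinite cyclic groups. -/
def freeFam (K : Type*) (I E : Type*) : I ⊕ E → Type _
  | Sum.inl _ => K
  | Sum.inr _ => ULift (Multiplicative ℤ)

variable {K I E P : Type*} [Group K] [Group P]

instance : ∀ j, Group (freeFam K I E j)
  | Sum.inl _ => inferInstanceAs (Group K)
  | Sum.inr _ => inferInstanceAs (Group (ULift (Multiplicative ℤ)))

theorem residuallyFinite_freeFam (hK : ResiduallyFinite K) :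
    ∀ j, ResiduallyFinite (freeFam K I E j)
  | Sum.inl _ => hK
  | Sum.inr _ => residuallyFinite_of_injective
      (MulEquiv.ulift : ULift (Multiplicative ℤ) ≃* Multiplicative ℤ).toMonoidHom
      (MulEquiv.ulift : ULift (Multiplicative ℤ) ≃* Multiplicative ℤ).injective
      residuallyFinite_multiplicative_int

/-- The generator of a cyclic factor. -/
def freeFamGen (e : E) : freeFam K I E (Sum.inr e) := ULift.up (Multiplicative.ofAdd 1)

/-- Homomorphisms from the factors of a `freeFam`. -/
def freeFamHom (a : I → K →* P) (b : E → P) : ∀ j, freeFam K I E j →* P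
  | Sum.inl i => a i
  | Sum.inr e => (zpowersHom P (b e)).comp MulEquiv.ulift.toMonoidHom

theorem freeFamHom_gen (a : I → K →* P) (b : E → P) (e : E) :
    freeFamHom a b (Sum.inr e) (freeFamGen e) = b e := by
  change zpowersHom P (b e) (Multiplicative.ofAdd 1) = b e
  simp

theorem freeFam_hom_ext {e : E} {f g : freeFam K I E (Sum.inr e) →* P}
    (h : f (freeFamGen e) = g (freeFamGen e)) : f = g := by
  have h' : f.comp (MulEquiv.ulift.symm : Multiplicative ℤ ≃* ULift (Multiplicative ℤ)).toMonoidHom =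
      g.comp (MulEquiv.ulift.symm : Multiplicative ℤ ≃* ULift (Multiplicative ℤ)).toMonoidHom :=
    MonoidHom.ext_mint h
  ext ⟨x⟩
  exact DFunLike.congr_fun h' x

end Family

theorem residuallyFinite_pushGroup (hK : ResiduallyFinite K) (hR : wordWt θ R = 0) (hpm : p ≠ m)
    (hp : IsUniqueMax (edgeWord θ 0 R) p ip) (hm : IsUniqueMin (edgeWord θ 0 R) m im) :
    ResiduallyFinite (pushGroup z R) := by
  intro g hg
  let s : HeightRep z R θ ℤ (edgeGroup z R θ) :=
    { ι := AddMonoidHom.id ℤ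
      surj := Function.surjective_id
      σ := edgeBase z R θ
      c := edgeLetter z R θ
      rel := evalWord_edgeLetter z R θ }
  obtain ⟨n, v, hnv⟩ : ∃ n v, s.toPerm hR g (0, 1) = (n, v) := ⟨_, _, rfl⟩
  by_cases hn : n = 0
  · subst hn
    have hv : v ≠ 1 := by
      rintro rfl
      let t : HeightRep z R θ Unit (pushGroup z R) :=
        { ι := 0
          surj := fun _ => ⟨0, rfl⟩
          σ := fun _ => pushBase z R
          c := fun x _ => pushLetter z R x
          rel := fun h => by rw [← evalWord_pushLetter, ← evalWord_fst_edgeWord θ _ h] }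
      have ht : ∀ a q, t.toPerm hR a ((), q) = ((), a * q) := by
        intro a
        induction a using push_induction with
        | base k => exact fun q => rfl
        | letter x =>
          intro q
          simp only [HeightRep.toPerm, pushLift_pushLetter]
          rfl
        | mul a b ha hb => simp [ha, hb, mul_assoc]
        | inv a ha =>
          intro q
          rw [map_inv, Equiv.Perm.inv_eq_iff_eq, ha, mul_inv_cancel_left]
      let ρ : edgeGroup z R θ →* pushGroup z R :=
        edgeLift (fun i => t.σ 0) (fun x i => t.c x 0) fun h => t.rel h
      have h2 := s.toPerm_map hR t 0 ρ (fun _ => rfl)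
        (fun i k => edgeLift_edgeBase ..) (fun x i => edgeLift_edgeLetter ..) g (0, 1)
      rw [hnv, map_one ρ] at h2
      exact hg (by simpa using congrArg Prod.snd ((ht g 1).symm.trans h2))
    let E := {e : Z × ℤ // IsFreeEdge p m ip im e}
    let Φ : ∀ j, freeFam K ℤ E j →* edgeGroup z R θ :=
      freeFamHom (edgeBase z R θ) fun e => edgeLetter z R θ e.1.1 e.1.2
    have hΦ : Function.Surjective (CoprodI.lift Φ) := by
      rw [← MonoidHom.range_eq_top]
      refine edgeGroup_subgroup_eq_top_of_free hpm hp hm _ (fun i k => ?_) fun e he => ?_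
      · exact ⟨CoprodI.of (M := freeFam K ℤ E) (i := Sum.inl i) k,
          CoprodI.lift_of (M := freeFam K ℤ E) Φ (i := Sum.inl i) k⟩
      · refine ⟨CoprodI.of (i := Sum.inr ⟨e, he⟩) (freeFamGen _), ?_⟩
        rw [CoprodI.lift_of]
        exact freeFamHom_gen _ _ _
    obtain ⟨w, rfl⟩ := hΦ v
    have hw : w ≠ 1 := fun h => hv (by rw [h, map_one])
    obtain ⟨P, _, _, τ, J₀, hτ⟩ := exists_finite_lift_ne_one (residuallyFinite_freeFam hK) w hw
    classical
    let ht : ℤ ⊕ E → ℤ := Sum.elim id fun e => e.1.2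
    let N := J₀.sup fun j => (ht j).natAbs
    have hN : ∀ j ∈ J₀, |ht j| ≤ N := fun j hj => by
      have := Finset.le_sup (f := fun j => (ht j).natAbs) hj
      rw [Int.abs_eq_natAbs]
      exact_mod_cast this
    obtain ⟨D, _, t, hι, hσ, hc⟩ := exists_finite_heightRep (z := z) hpm hp hm
      (fun i => τ (Sum.inl i))
      (fun x i => if h : IsFreeEdge p m ip im (x, i) then τ (Sum.inr ⟨(x, i), h⟩) (freeFamGen _)
        else 1) N
    have hrel : ∀ h : ℤ, evalWord (fun e : Z × ℤ => t.c e.1 e.2) (edgeWord θ h R) = t.σ h z :=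
      fun h => by simpa only [hι] using t.rel h
    let ρ : edgeGroup z R θ →* P := edgeLift (fun i => t.σ i) (fun x i => t.c x i) hrel
    refine ⟨Equiv.Perm (ZMod D × P), inferInstance, inferInstance, t.toPerm hR, fun h1 => ?_⟩
    have h2 := s.toPerm_map hR t (Int.castAddHom _) ρ (fun h => (hι h).symm)
      (fun i k => edgeLift_edgeBase ..) (fun x i => edgeLift_edgeLetter ..) g (0, 1)
    rw [hnv, h1] at h2
    simp only [map_zero, map_one, Equiv.Perm.one_apply, Prod.mk.injEq, true_and] at h2
    refine hτ (fun j => ρ.comp (Φ j)) (fun j hj => ?_) ?_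
    · have hj' := hN j hj
      rcases j with i | e
      · ext k
        refine (edgeLift_edgeBase z R θ (fun i => t.σ i) (fun x i => t.c x i) hrel i k).trans ?_
        exact DFunLike.congr_fun (hσ i hj') k
      · refine freeFam_hom_ext ?_
        rw [MonoidHom.comp_apply]
        simp only [Φ, freeFamHom_gen]
        refine (edgeLift_edgeLetter ..).trans ?_
        exact (hc _ _ hj' e.2).trans (dif_pos e.2)
    · rw [h2]
      refine DFunLike.congr_fun (f := CoprodI.lift fun j => ρ.comp (Φ j))
        (g := ρ.comp (CoprodI.lift Φ)) (CoprodI.ext_hom _ _ fun j => ?_) w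
      ext x
      simp
  · let t : HeightRep z R θ (ZMod (n.natAbs + 1)) Unit :=
      { ι := Int.castAddHom _
        surj := ZMod.intCast_surjective
        σ := 1
        c := 1
        rel := fun _ => rfl }
    refine ⟨Equiv.Perm (ZMod (n.natAbs + 1) × Unit), inferInstance, inferInstance, t.toPerm hR,
      fun h1 => hn ?_⟩
    have h2 := s.toPerm_map hR t (Int.castAddHom _) 1 (fun _ => rfl)
      (fun _ _ => rfl) (fun _ _ => rfl) g (0, 1)
    rw [hnv, h1] at h2
    have h3 : ((n : ℤ) : ZMod (n.natAbs + 1)) = 0 := by simpa using (congrArg Prod.fst h2).symm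
    rw [ZMod.intCast_zmod_eq_zero_iff_dvd] at h3
    exact Int.eq_zero_of_abs_lt_dvd h3 (by rw [Int.abs_eq_natAbs]; lia)

end Finite

section Skeleton
variable {X : Type*} {θ : X → ℤ} {W : List (X × Bool)}

theorem length_edgeWord (θ : X → ℤ) (h : ℤ) (W : List (X × Bool)) :
    (edgeWord θ h W).length = W.length := by
  induction W generalizing h with
  | nil => rfl
  | cons a W ih => simp [edgeWord, ih]

theorem phiW_succ (θ : X → ℤ) {j : ℕ} (hj : j < W.length) :
    phiW θ W (j + 1) = phiW θ W j + letterWt θ W[j] := by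
  simp only [phiW, List.map_take]
  rw [List.sum_take_succ _ _ (by simpa using hj)]
  simp [letterWt]

theorem getElem_edgeWord (θ : X → ℤ) (h : ℤ) (W : List (X × Bool)) (j : ℕ)
    (hj : j < (edgeWord θ h W).length) (hj' : j < W.length) :
    (edgeWord θ h W)[j] =
      ((W[j].1, h + if W[j].2 then phiW θ W j else phiW θ W (j + 1)), W[j].2) := by
  induction W generalizing h j with
  | nil => simp at hj'
  | cons a W ih =>
    cases j with
    | zero => cases ha : a.2 <;> simp [edgeWord, phiW, ha, sub_eq_add_neg]
    | succ j =>
      have hj'' : j < W.length := by simpa using hj'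
      have hs : ∀ i, phiW θ (a :: W) (i + 1) = letterWt θ a + phiW θ W i := fun i => by
        simp [phiW, letterWt]
      simp only [edgeWord, List.getElem_cons_succ, hs]
      rw [ih _ _ _ hj'']
      split_ifs <;> simp [add_assoc]

theorem exists_isUniqueMax_edgeWord (h0 : IsAdmissible θ W) {k : Fin W.length}
    (hk : ∀ j : Fin W.length, j ≠ k → phiW θ W (j.1 + 1) < phiW θ W (k.1 + 1))
    (hne : (W.get k).1 ≠ (W.get (succIdx W k)).1) {n : Fin W.length}
    (hn : n = k ∨ n = succIdx W k) : ∃ i, IsUniqueMax (edgeWord θ 0 W) (W.get n).1 i := by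
  have hφ0 : phiW θ W 0 = 0 := rfl
  have hsucc : (succIdx W k).1 = k.1 + 1 ∨ k.1 + 1 = W.length ∧ (succIdx W k).1 = 0 := by
    have := k.2
    rcases Nat.lt_or_ge (k.1 + 1) W.length with h | h
    · exact Or.inl (Nat.mod_eq_of_lt h)
    · have h : k.1 + 1 = W.length := by lia
      exact Or.inr ⟨h, by simp [succIdx, h]⟩
  have hsucc' : phiW θ W (succIdx W k).1 = phiW θ W (k.1 + 1) := by
    rcases hsucc with h | ⟨h, h'⟩
    · rw [h]
    · rw [h', h, h0, hφ0]
  have hle : ∀ j : Fin W.length, phiW θ W (j.1 + 1) ≤ phiW θ W (k.1 + 1) := fun j => by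
    rcases eq_or_ne j k with rfl | h
    · exact le_rfl
    · exact (hk j h).le
  have hlt : ∀ j : Fin W.length, j ≠ succIdx W k → phiW θ W j.1 < phiW θ W (k.1 + 1) := by
    intro j hj
    have hjv : j.1 ≠ (succIdx W k).1 := fun h => hj (Fin.ext h)
    rcases Nat.eq_zero_or_pos j.1 with h | h
    · have hl : phiW θ W 0 = phiW θ W (W.length - 1 + 1) := by
        rw [hφ0, Nat.sub_add_cancel (by have := j.2; lia), h0]
      rw [h, hl]
      exact hk ⟨W.length - 1, by have := j.2; lia⟩ fun h' => by
        have := congrArg Fin.val h'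
        simp only at this
        have := j.2
        lia
    · have := hk ⟨j.1 - 1, by have := j.2; lia⟩ fun h' => by
        have := congrArg Fin.val h'
        simp only at this
        have := j.2
        lia
      simpa only [Nat.sub_add_cancel h] using this
  have hle' : ∀ j : Fin W.length, phiW θ W j.1 ≤ phiW θ W (k.1 + 1) := fun j => by
    rcases eq_or_ne j (succIdx W k) with rfl | h
    · exact hsucc'.le
    · exact (hlt j h).le
  let idx : Fin W.length → ℤ := fun j =>
    if (W.get j).2 then phiW θ W j.1 else phiW θ W (j.1 + 1)
  have hidx : ∀ j, idx j + max (θ (W.get j).1) 0 = max (phiW θ W j.1) (phiW θ W (j.1 + 1)) := by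
    intro j
    have h := phiW_succ θ j.2
    simp only [idx, List.get_eq_getElem]
    unfold letterWt at h
    split_ifs at h ⊢ <;> lia
  have hget : ∀ j (hj : j < (edgeWord θ 0 W).length) (hj' : j < W.length), (edgeWord θ 0 W)[j] =
      (((W.get ⟨j, hj'⟩).1, idx ⟨j, hj'⟩), (W.get ⟨j, hj'⟩).2) := by
    intro j hj hj'
    rw [getElem_edgeWord θ 0 W j hj hj', zero_add]
    rfl
  have hlen := length_edgeWord θ 0 W
  have hn' : n.1 < (edgeWord θ 0 W).length := by rw [hlen]; exact n.2
  have hmain : ∀ j, j ≠ n → (W.get j).1 = (W.get n).1 → idx j < idx n := by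
    intro j hj hjn
    have h1 := hidx j
    have h2 := hidx n
    rw [hjn] at h1
    have hjk : j ≠ k := by
      rintro rfl
      rcases hn with rfl | rfl
      · exact hj rfl
      · exact hne hjn
    have hjs : j ≠ succIdx W k := by
      rintro rfl
      rcases hn with rfl | rfl
      · exact hne hjn.symm
      · exact hj rfl
    have h3 := hk j hjk
    have h4 := hlt j hjs
    have h5 : phiW θ W (k.1 + 1) ≤ max (phiW θ W n.1) (phiW θ W (n.1 + 1)) := by
      rcases hn with rfl | rfl
      · exact le_max_right _ _
      · exact hsucc'.ge.trans (le_max_left _ _)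
    have h6 := max_lt h4 h3
    lia
  refine ⟨idx n, (edgeWord θ 0 W).take n, (edgeWord θ 0 W).drop (n + 1), (W.get n).2, ?_, ?_⟩
  · have h := hget n hn' n.2
    rw [← h, ← List.drop_eq_getElem_cons hn', List.take_append_drop]
  · intro b hb hbn
    obtain ⟨j, hj, hjn, rfl⟩ : ∃ (j : ℕ) (hj : j < (edgeWord θ 0 W).length), j ≠ n.1 ∧
        (edgeWord θ 0 W)[j] = b := by
      rcases List.mem_append.1 hb with hb | hb
      · obtain ⟨j, hj, rfl⟩ := List.mem_take_iff_getElem.1 hb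
        exact ⟨j, by lia, by lia, rfl⟩
      · obtain ⟨j, hj, rfl⟩ := List.mem_drop_iff_getElem.1 hb
        exact ⟨_, by lia, by lia, rfl⟩
    have hj' : j < W.length := hlen ▸ hj
    rw [hget j hj hj'] at hbn ⊢
    exact hmain ⟨j, hj'⟩ (fun h => hjn (congrArg Fin.val h)) hbn

theorem phiW_neg (θ : X → ℤ) (W : List (X × Bool)) (j : ℕ) : phiW (-θ) W j = -phiW θ W j := by
  unfold phiW
  induction W.take j with
  | nil => rfl
  | cons a l ih =>
    rw [List.map_cons, List.sum_cons, List.map_cons, List.sum_cons, ih, neg_add]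
    congr 1
    split_ifs <;> rfl

theorem edgeWord_neg (θ : X → ℤ) (h : ℤ) (W : List (X × Bool)) :
    edgeWord (-θ) (-h) W = (edgeWord θ h W).map fun e => ((e.1.1, -e.1.2), e.2) := by
  induction W generalizing h with
  | nil => rfl
  | cons a W ih =>
    have : -h + letterWt (-θ) a = -(h + letterWt θ a) := by
      unfold letterWt
      split_ifs <;> simp <;> ring
    rw [edgeWord, edgeWord, this, ih, List.map_cons]
    congr 3
    split_ifs <;> simp
    ring

theorem IsUniqueMax.neg {e : List ((X × ℤ) × Bool)} {p : X} {i : ℤ}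
    (h : IsUniqueMax (e.map fun e => ((e.1.1, -e.1.2), e.2)) p i) : IsUniqueMin e p (-i) := by
  obtain ⟨A, B, ε, he, h⟩ := h
  obtain ⟨A, B', rfl, rfl, hB⟩ := List.map_eq_append_iff.1 he
  obtain ⟨⟨⟨x, j⟩, ε'⟩, B, rfl, hx, rfl⟩ := List.map_eq_cons_iff.1 hB
  simp only [Prod.mk.injEq] at hx
  obtain ⟨⟨rfl, rfl⟩, rfl⟩ := hx
  refine ⟨A, B, ε', by simp, fun b hb hbx => ?_⟩
  rw [← List.map_append] at h
  have := h _ (List.mem_map_of_mem hb) hbx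
  simp only at this
  lia

theorem exists_isUniqueMin_edgeWord (h0 : IsAdmissible θ W) {k : Fin W.length}
    (hk : ∀ j : Fin W.length, j ≠ k → phiW θ W (k.1 + 1) < phiW θ W (j.1 + 1))
    (hne : (W.get k).1 ≠ (W.get (succIdx W k)).1) {n : Fin W.length}
    (hn : n = k ∨ n = succIdx W k) : ∃ i, IsUniqueMin (edgeWord θ 0 W) (W.get n).1 i := by
  have h0' : IsAdmissible (-θ) W := by
    unfold IsAdmissible at h0 ⊢
    rw [phiW_neg, h0, neg_zero]
  obtain ⟨i, hi⟩ := exists_isUniqueMax_edgeWord h0'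
    (fun j hj => by rw [phiW_neg, phiW_neg]; exact neg_lt_neg (hk j hj)) hne hn
  rw [← neg_zero, edgeWord_neg] at hi
  exact ⟨-i, hi.neg⟩

end Skeleton

section Flat
variable {X Y A : Type*}

open Classical in
/-- The relator of a relative presentation over a free group, as a word in the letters of the
alphabet and of the free group. -/
noncomputable def flatWord (R : List (X × Bool × FreeGroup A)) : List ((X ⊕ A) × Bool) :=
  R.flatMap fun t => (Sum.inl t.1, t.2.1) :: t.2.2.toWord.map fun a => (Sum.inr a.1, a.2)

open Classical in
theorem flatWord_cons (t : X × Bool × FreeGroup A) (R : List (X × Bool × FreeGroup A)) :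
    flatWord (t :: R) =
      (Sum.inl t.1, t.2.1) :: ((t.2.2.toWord.map fun a => (Sum.inr a.1, a.2)) ++ flatWord R) := by
  simp [flatWord]

theorem map_coprodInlX_relWord {P : Type*} [Group P]
    (F : Coprod (FreeGroup A) (FreeGroup (X ⊕ Y)) →* P) (R : List (X × Bool × FreeGroup A)) :
    F (coprodInlX (relWord R)) =
      evalWord (Sum.elim (fun x => F (Coprod.inr (FreeGroup.of (Sum.inl x))))
        fun a => F (Coprod.inl (FreeGroup.of a))) (flatWord R) := by
  classical
  induction R with
  | nil => simp [relWord, flatWord, evalWord]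
  | cons t R ih =>
    obtain ⟨x, ε, h⟩ := t
    have hF : F (Coprod.inl h) = evalWord (fun a => F (Coprod.inl (FreeGroup.of a))) h.toWord := by
      rw [← lift_mk_eq_evalWord, FreeGroup.mk_toWord]
      exact DFunLike.congr_fun (FreeGroup.ext_hom (F.comp Coprod.inl) _ fun a => by simp) h
    have h1 : relWord ((x, ε, h) :: R) =
        Coprod.inr (FreeGroup.mk [(x, ε)]) * Coprod.inl h * relWord R := by simp [relWord]
    have h3 : ∀ c : X ⊕ A → P, evalWord c (h.toWord.map fun a => (Sum.inr a.1, a.2)) =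
        evalWord (fun a => c (Sum.inr a)) h.toWord := fun c => by
      simp [evalWord, Function.comp_def]
    rw [h1, flatWord_cons, map_mul, map_mul, ih, evalWord_cons, evalWord_append, h3, map_mul,
      map_mul, mul_assoc]
    congr 1
    swap
    · exact congrArg₂ _ hF rfl
    · cases ε
      · have : FreeGroup.mk [(x, false)] = (FreeGroup.of x)⁻¹ := rfl
        simp [coprodInlX, this]
      · have : FreeGroup.mk [(x, true)] = FreeGroup.of x := rfl
        simp [coprodInlX, this]

variable (θ : X → ℤ)

theorem edgeWord_map_inr (h : ℤ) (l : List (A × Bool)) :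
    edgeWord (Sum.elim θ 0) h (l.map fun a => (Sum.inr a.1, a.2)) =
      l.map fun a => ((Sum.inr a.1, h), a.2) := by
  induction l generalizing h with
  | nil => rfl
  | cons a l ih => simp [edgeWord, letterWt, ih]

theorem wordWt_map_inr (l : List (A × Bool)) :
    wordWt (Sum.elim θ 0) (l.map fun a => (Sum.inr a.1, a.2)) = 0 := by
  simp [wordWt, letterWt, Function.comp_def]

theorem wordWt_flatWord (R : List (X × Bool × FreeGroup A)) :
    wordWt (Sum.elim θ 0) (flatWord R) = phiW θ (skel R) (skel R).length := by
  classical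
  rw [phiW, List.take_length]
  induction R with
  | nil => rfl
  | cons t R ih =>
    have h := wordWt_map_inr θ t.2.2.toWord
    rw [flatWord_cons]
    simp only [wordWt] at ih h ⊢
    rw [List.map_cons, List.sum_cons, List.map_append, List.sum_append, h, ih, zero_add]
    rfl

/-- The edge over `X` given by an edge over `X ⊕ A`, if any. -/
def edgeInl? (e : ((X ⊕ A) × ℤ) × Bool) : Option ((X × ℤ) × Bool) :=
  e.1.1.getLeft?.map fun x => ((x, e.1.2), e.2)

theorem filterMap_edgeWord_flatWord (h : ℤ) (R : List (X × Bool × FreeGroup A)) :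
    (edgeWord (Sum.elim θ 0) h (flatWord R)).filterMap edgeInl? = edgeWord θ h (skel R) := by
  classical
  induction R generalizing h with
  | nil => rfl
  | cons t R ih =>
    have h3 : skel (t :: R) = (t.1, t.2.1) :: skel R := rfl
    rw [flatWord_cons, h3, edgeWord, edgeWord, edgeWord_append, wordWt_map_inr, edgeWord_map_inr, add_zero,
      List.filterMap_cons_some (f := edgeInl?) (b := ((t.1, if t.2.1 then h else h - θ t.1), t.2.1)) rfl,
      List.filterMap_append, ih, List.filterMap_eq_nil_iff.2, List.nil_append]
    · rfl
    · intro b hb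
      obtain ⟨a, -, rfl⟩ := List.mem_map.1 hb
      rfl

theorem exists_of_filterMap_edgeInl? {e : List (((X ⊕ A) × ℤ) × Bool)} {A' B'} {p : X} {i : ℤ}
    {ε : Bool} (he : e.filterMap edgeInl? = A' ++ ((p, i), ε) :: B') :
    ∃ A B, e = A ++ ((Sum.inl p, i), ε) :: B ∧
      ∀ b ∈ A ++ B, b.1.1 = Sum.inl p → ((p, b.1.2), b.2) ∈ A' ++ B' := by
  obtain ⟨A, B₁, rfl, rfl, hB⟩ := List.filterMap_eq_append_iff.1 he
  obtain ⟨C, a, B, rfl, hC, ha, rfl⟩ := List.filterMap_eq_cons_iff.1 hB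
  obtain ⟨⟨x | x, j⟩, ε'⟩ := a
  · simp only [edgeInl?, Sum.getLeft?_inl, Option.map_some, Option.some.injEq, Prod.mk.injEq] at ha
    obtain ⟨⟨rfl, rfl⟩, rfl⟩ := ha
    refine ⟨A ++ C, B, by simp, fun b hb hbp => ?_⟩
    have : edgeInl? b = some ((x, b.1.2), b.2) := by simp [edgeInl?, hbp]
    have hb' := List.mem_filterMap.2 ⟨b, hb, this⟩
    rwa [List.filterMap_append, List.filterMap_append, List.filterMap_eq_nil_iff.2 hC,
      List.append_nil] at hb'
  · simp [edgeInl?] at ha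

theorem IsUniqueMax.of_filterMap {e : List (((X ⊕ A) × ℤ) × Bool)} {p : X} {i : ℤ}
    (h : IsUniqueMax (e.filterMap edgeInl?) p i) : IsUniqueMax e (Sum.inl p) i := by
  obtain ⟨A', B', ε, he, h⟩ := h
  obtain ⟨A, B, rfl, h'⟩ := exists_of_filterMap_edgeInl? he
  exact ⟨A, B, ε, rfl, fun b hb hbp => h _ (h' b hb hbp) rfl⟩

theorem IsUniqueMin.of_filterMap {e : List (((X ⊕ A) × ℤ) × Bool)} {p : X} {i : ℤ}
    (h : IsUniqueMin (e.filterMap edgeInl?) p i) : IsUniqueMin e (Sum.inl p) i := by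
  obtain ⟨A', B', ε, he, h⟩ := h
  obtain ⟨A, B, rfl, h'⟩ := exists_of_filterMap_edgeInl? he
  exact ⟨A, B, ε, rfl, fun b hb hbp => h _ (h' b hb hbp) rfl⟩

theorem exists_extremes_flatWord {R : List (X × Bool × FreeGroup A)}
    (hP : HasUniqueMaxMin (skel R)) :
    ∃ (θ : X ⊕ A → ℤ) (p m : X ⊕ A) (ip im : ℤ), wordWt θ (flatWord R) = 0 ∧ p ≠ m ∧
      IsUniqueMax (edgeWord θ 0 (flatWord R)) p ip ∧
      IsUniqueMin (edgeWord θ 0 (flatWord R)) m im := by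
  obtain ⟨θ, -, -, -, h0, k, l, hk, hl, hkne, hlne⟩ := hP
  obtain ⟨ip, hp⟩ := exists_isUniqueMax_edgeWord h0 hk hkne (Or.inl rfl)
  obtain ⟨m, hm, im, him⟩ : ∃ m, ((skel R).get k).1 ≠ m ∧
      ∃ i, IsUniqueMin (edgeWord θ 0 (skel R)) m i := by
    by_cases h : ((skel R).get k).1 = ((skel R).get l).1
    · exact ⟨_, h ▸ hlne, exists_isUniqueMin_edgeWord h0 hl hlne (Or.inr rfl)⟩
    · exact ⟨_, h, exists_isUniqueMin_edgeWord h0 hl hlne (Or.inl rfl)⟩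
  refine ⟨Sum.elim θ 0, Sum.inl _, Sum.inl m, ip, im, ?_, fun h => hm (Sum.inl_injective h),
    IsUniqueMax.of_filterMap ?_, IsUniqueMin.of_filterMap ?_⟩
  · rw [wordWt_flatWord]
    exact h0
  · rwa [filterMap_edgeWord_flatWord]
  · rwa [filterMap_edgeWord_flatWord]

end Flat

section Substitution
variable {X Y A : Type*} (R : List (X × Bool × FreeGroup A)) (S : List (Option Y × Bool))

/-- The value of the relator `R` in `substGroup R S`. -/
def substRel : substGroup R S := QuotientGroup.mk' _ (coprodInlX (relWord R))

/-- The images in `substGroup R S` of the generators of `oneRelatorGroup S`. -/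
def substGen : Option Y → substGroup R S :=
  fun o => o.elim (substRel R S) fun y => QuotientGroup.mk' _ (Coprod.inr (FreeGroup.of (Sum.inr y)))

theorem map_substWord {P : Type*} [Group P]
    (F : Coprod (FreeGroup A) (FreeGroup (X ⊕ Y)) →* P) :
    F (substWord R S) = evalWord (fun o => o.elim (F (coprodInlX (relWord R)))
      fun y => F (Coprod.inr (FreeGroup.of (Sum.inr y)))) S := by
  unfold substWord evalWord
  rw [map_list_prod, List.map_map]
  congr 1
  refine List.map_congr_left fun a _ => ?_
  obtain ⟨_ | y, _ | _⟩ := a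
  · simp
  · simp
  · have : FreeGroup.mk [((Sum.inr y : X ⊕ Y), false)] = (FreeGroup.of (Sum.inr y))⁻¹ := rfl
    simp [this]
  · rfl

/-- The natural homomorphism from `oneRelatorGroup S`. -/
def substBase : oneRelatorGroup S →* substGroup R S :=
  QuotientGroup.lift _ (FreeGroup.lift (substGen R S)) <| by
    refine Subgroup.normalClosure_le_normal (N := (FreeGroup.lift (substGen R S)).ker) ?_
    rintro _ rfl
    rw [SetLike.mem_coe, MonoidHom.mem_ker, lift_mk_eq_evalWord]
    refine (map_substWord R S (QuotientGroup.mk' _)).symm.trans ?_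
    exact (QuotientGroup.eq_one_iff _).2 (Subgroup.subset_normalClosure rfl)

/-- The generators of `oneRelatorGroup S`. -/
def oneRelGen (o : Option Y) : oneRelatorGroup S := QuotientGroup.mk' _ (FreeGroup.of o)

theorem evalWord_oneRelGen : evalWord (oneRelGen S) S = 1 := by
  have h : FreeGroup.lift (oneRelGen S) = QuotientGroup.mk' _ :=
    FreeGroup.ext_hom _ _ fun _ => FreeGroup.lift_apply_of
  rw [← lift_mk_eq_evalWord, h]
  exact (QuotientGroup.eq_one_iff _).2 (Subgroup.subset_normalClosure rfl)

theorem substBase_oneRelGen (o : Option Y) : substBase R S (oneRelGen S o) = substGen R S o := by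
  change FreeGroup.lift (substGen R S) (FreeGroup.of o) = _
  exact FreeGroup.lift_apply_of

/-- The homomorphism of free products underlying `substToPush`. -/
noncomputable def coprodToPush :
    Coprod (FreeGroup A) (FreeGroup (X ⊕ Y)) →* pushGroup (oneRelGen S none) (flatWord R) :=
  Coprod.lift (FreeGroup.lift fun a => pushLetter _ _ (Sum.inr a))
    (FreeGroup.lift (Sum.elim (fun x => pushLetter _ _ (Sum.inl x))
      fun y => pushBase _ _ (oneRelGen S (some y))))

theorem coprodToPush_inl (a : A) : coprodToPush R S (Coprod.inl (FreeGroup.of a)) =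
    pushLetter _ _ (Sum.inr a) := by simp [coprodToPush]

theorem coprodToPush_inr_inl (x : X) : coprodToPush R S (Coprod.inr (FreeGroup.of (Sum.inl x))) =
    pushLetter _ _ (Sum.inl x) := by simp [coprodToPush]

theorem coprodToPush_inr_inr (y : Y) : coprodToPush R S (Coprod.inr (FreeGroup.of (Sum.inr y))) =
    pushBase _ _ (oneRelGen S (some y)) := by simp [coprodToPush]

theorem coprodToPush_relWord : coprodToPush R S (coprodInlX (relWord R)) =
    pushBase (oneRelGen S none) (flatWord R) (oneRelGen S none) := by
  rw [map_coprodInlX_relWord, ← evalWord_pushLetter]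
  refine evalWord_congr fun a _ => ?_
  rcases a.1 with x | a <;> simp [coprodToPush_inl, coprodToPush_inr_inl]

/-- `substGroup R S` maps to the group obtained from `oneRelatorGroup S` by adjoining letters and
identifying `R` with the distinguished generator. -/
noncomputable def substToPush : substGroup R S →* pushGroup (oneRelGen S none) (flatWord R) :=
  QuotientGroup.lift _ (coprodToPush R S) <| by
    refine Subgroup.normalClosure_le_normal (N := (coprodToPush R S).ker) ?_
    rintro _ rfl
    rw [SetLike.mem_coe, MonoidHom.mem_ker, map_substWord, coprodToPush_relWord]
    rw [← map_one (pushBase (oneRelGen S none) (flatWord R)), ← evalWord_oneRelGen, map_evalWord]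
    refine evalWord_congr fun a _ => ?_
    rcases a.1 with _ | y
    · rfl
    · exact coprodToPush_inr_inr R S y

/-- The inverse of `substToPush`. -/
noncomputable def pushToSubst : pushGroup (oneRelGen S none) (flatWord R) →* substGroup R S :=
  pushLift (substBase R S)
    (Sum.elim (fun x => QuotientGroup.mk' _ (Coprod.inr (FreeGroup.of (Sum.inl x))))
      fun a => QuotientGroup.mk' _ (Coprod.inl (FreeGroup.of a))) <|
    (map_coprodInlX_relWord (QuotientGroup.mk' _) R).symm.trans <| by
      rw [substBase_oneRelGen]
      rfl

theorem substToPush_injective : Function.Injective (substToPush R S) := by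
  have h : ((pushToSubst R S).comp (substToPush R S)).comp (QuotientGroup.mk' _) =
      QuotientGroup.mk' _ := by
    refine Coprod.hom_ext (FreeGroup.ext_hom _ _ fun a => ?_) (FreeGroup.ext_hom _ _ fun x => ?_)
    · refine (congrArg (pushToSubst R S) (coprodToPush_inl R S a)).trans ?_
      exact pushLift_pushLetter ..
    · rcases x with x | y
      · refine (congrArg (pushToSubst R S) (coprodToPush_inr_inl R S x)).trans ?_
        exact pushLift_pushLetter ..
      · refine (congrArg (pushToSubst R S) (coprodToPush_inr_inr R S y)).trans ?_
        exact (pushLift_pushBase ..).trans (substBase_oneRelGen R S _)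
  refine Function.LeftInverse.injective (g := pushToSubst R S) fun g => ?_
  obtain ⟨g, rfl⟩ := QuotientGroup.mk'_surjective _ g
  exact DFunLike.congr_fun h g

theorem substToPush_substBase (k : oneRelatorGroup S) :
    substToPush R S (substBase R S k) = pushBase (oneRelGen S none) (flatWord R) k := by
  have h : ((substToPush R S).comp (substBase R S)).comp (QuotientGroup.mk' _) =
      (pushBase (oneRelGen S none) (flatWord R)).comp (QuotientGroup.mk' _) := by
    refine FreeGroup.ext_hom _ _ fun o => ?_
    refine (congrArg (substToPush R S) (substBase_oneRelGen R S o)).trans ?_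
    rcases o with _ | y
    · exact coprodToPush_relWord R S
    · exact coprodToPush_inr_inr R S y
  obtain ⟨k, rfl⟩ := QuotientGroup.mk'_surjective _ k
  exact DFunLike.congr_fun h k

end Substitution

/-- **Theorem 4**, second part (Pride). Let `Φ` be a free group,
`P = ⟨x, Φ; R⟩` an `M_Φ`-presentation and `K = ⟨y, z; S(y,z)⟩` a one-relator
group. Then the one-relator group `K̄ = ⟨x, y, Φ; S(y, R)⟩`, obtained by
substituting `R` for every occurrence of `z^{±1}` in `S`, is residually finite
iff `K` is residually finite. -/
theorem substGroup_residuallyFinite_iff_of_free {X Y A : Type*}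
    (R : List (X × Bool × FreeGroup A)) (hP : HasUniqueMaxMin (skel R))
    (S : List (Option Y × Bool)) (hS : S ≠ []) :
    ResiduallyFinite (substGroup R S) ↔ ResiduallyFinite (oneRelatorGroup S) := by
  obtain ⟨θ, p, m, ip, im, hθ, hpm, hp, hm⟩ := exists_extremes_flatWord hP
  constructor
  · refine residuallyFinite_of_injective (substBase R S) (Function.Injective.of_comp
      (f := substToPush R S) ?_)
    rw [show substToPush R S ∘ substBase R S = pushBase (oneRelGen S none) (flatWord R) from
      funext (substToPush_substBase R S)]
    exact pushBase_injective hθ hp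
  · exact fun h => residuallyFinite_of_injective _ (substToPush_injective R S)
      (residuallyFinite_pushGroup h hθ hpm hp hm)
end

section
/- Let Φ be a free group and P = ⟨x, Φ; R⟩ an M_Φ-presentation. Then for every integer n > 1 the one-relator group G_n = ⟨x, Φ; R^n⟩ is residually finite. -/
open Monoid

/-- The group defined by the relative one-relator presentation `⟨x, H; Rⁿ⟩`,
whose single relator is the `n`-th power of `R`. -/
def relGroupPow {X H : Type*} [Group H] (R : List (X × Bool × H)) (n : ℕ) : Type _ :=
  Coprod H (FreeGroup X) ⧸ Subgroup.normalClosure {relWord R ^ n}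

instance {X H : Type*} [Group H] (R : List (X × Bool × H)) (n : ℕ) :
    Group (relGroupPow R n) := QuotientGroup.Quotient.group _

section Walks

variable {B P Q : Type*}

/-- The vertex reached from `i` by traversing the letter `l`. -/
def letterNext (θ : B → ℤ) (i : ℤ) (l : B × Bool) : ℤ :=
  if l.2 then i + θ l.1 else i - θ l.1

/-- The edge traversed by the letter `l` from the vertex `i`. The edge `(b, j)` joins `j` to
`j + θ b`. -/
def letterEdge (θ : B → ℤ) (i : ℤ) (l : B × Bool) : B × ℤ :=
  (l.1, if l.2 then i else i - θ l.1)

/-- The end of the path spelled by a word from the vertex `i`. -/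
def walkEnd (θ : B → ℤ) : ℤ → List (B × Bool) → ℤ
  | i, [] => i
  | i, l :: w => walkEnd θ (letterNext θ i l) w

/-- The edges traversed by the path spelled by a word from the vertex `i`. -/
def walkEdges (θ : B → ℤ) : ℤ → List (B × Bool) → List (B × ℤ)
  | _, [] => []
  | i, l :: w => letterEdge θ i l :: walkEdges θ (letterNext θ i l) w

/-- The value of an edge labelling `c` along the path spelled by a word from the vertex `i`. -/
def walkEval [Group P] (θ : B → ℤ) (c : B × ℤ → P) : ℤ → List (B × Bool) → P
  | _, [] => 1
  | i, l :: w => (if l.2 then c (letterEdge θ i l) else (c (letterEdge θ i l))⁻¹) *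
      walkEval θ c (letterNext θ i l) w

variable (θ : B → ℤ)

theorem walkEnd_append (i : ℤ) (u v : List (B × Bool)) :
    walkEnd θ i (u ++ v) = walkEnd θ (walkEnd θ i u) v := by
  induction u generalizing i with
  | nil => rfl
  | cons l u ih => simp [walkEnd, ih]

theorem walkEdges_append (i : ℤ) (u v : List (B × Bool)) :
    walkEdges θ i (u ++ v) = walkEdges θ i u ++ walkEdges θ (walkEnd θ i u) v := by
  induction u generalizing i with
  | nil => rfl
  | cons l u ih => simp [walkEnd, walkEdges, ih]

theorem letterNext_add (i t : ℤ) (l : B × Bool) :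
    letterNext θ (i + t) l = letterNext θ i l + t := by
  unfold letterNext; split <;> ring

theorem letterEdge_add (i t : ℤ) (l : B × Bool) :
    letterEdge θ (i + t) l = ((letterEdge θ i l).1, (letterEdge θ i l).2 + t) := by
  unfold letterEdge; split <;> simp; ring

theorem walkEnd_add (i t : ℤ) (w : List (B × Bool)) :
    walkEnd θ (i + t) w = walkEnd θ i w + t := by
  induction w generalizing i with
  | nil => rfl
  | cons l u ih => rw [walkEnd, letterNext_add, ih, walkEnd]

theorem walkEdges_add (i t : ℤ) (w : List (B × Bool)) :
    walkEdges θ (i + t) w = (walkEdges θ i w).map fun e => (e.1, e.2 + t) := by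
  induction w generalizing i with
  | nil => rfl
  | cons l u ih => simp [walkEdges, letterNext_add, ih, letterEdge_add]

theorem mem_walkEdges_add {i t : ℤ} {w : List (B × Bool)} {e : B × ℤ} :
    e ∈ walkEdges θ (i + t) w ↔ (e.1, e.2 - t) ∈ walkEdges θ i w := by
  rw [walkEdges_add, List.mem_map]
  constructor
  · rintro ⟨a, ha, rfl⟩
    simpa using ha
  · exact fun h => ⟨_, h, by simp⟩

theorem mem_walkEdges {t : ℤ} {w : List (B × Bool)} {e : B × ℤ} :
    e ∈ walkEdges θ t w ↔ (e.1, e.2 - t) ∈ walkEdges θ 0 w := by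
  simpa using mem_walkEdges_add (i := 0) (t := t) (w := w) (e := e) θ

theorem fst_mem_of_mem_walkEdges {i : ℤ} {w : List (B × Bool)} {e : B × ℤ}
    (h : e ∈ walkEdges θ i w) : e.1 ∈ w.map Prod.fst := by
  induction w generalizing i with
  | nil => simp [walkEdges] at h
  | cons l u ih =>
    rw [walkEdges, List.mem_cons] at h
    rcases h with rfl | h
    · simp [letterEdge]
    · exact List.mem_cons_of_mem _ (ih h)

variable [Group P] [Group Q]

theorem walkEval_append (c : B × ℤ → P) (i : ℤ) (u v : List (B × Bool)) :
    walkEval θ c i (u ++ v) = walkEval θ c i u * walkEval θ c (walkEnd θ i u) v := by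
  induction u generalizing i with
  | nil => simp [walkEval, walkEnd]
  | cons l u ih => simp [walkEval, walkEnd, ih, mul_assoc]

theorem walkEval_congr_add {c c' : B × ℤ → P} {i t : ℤ} {w : List (B × Bool)}
    (h : ∀ e ∈ walkEdges θ i w, c e = c' (e.1, e.2 + t)) :
    walkEval θ c i w = walkEval θ c' (i + t) w := by
  induction w generalizing i with
  | nil => rfl
  | cons l u ih =>
    simp only [walkEdges, List.mem_cons, forall_eq_or_imp] at h
    rw [walkEval, walkEval, letterNext_add, letterEdge_add, h.1, ih h.2]

theorem walkEval_congr {c c' : B × ℤ → P} {i : ℤ} {w : List (B × Bool)}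
    (h : ∀ e ∈ walkEdges θ i w, c e = c' e) : walkEval θ c i w = walkEval θ c' i w := by
  simpa using walkEval_congr_add (t := 0) (c := c) (c' := c') θ (by simpa using h)

theorem map_walkEval (f : P →* Q) (c : B × ℤ → P) (i : ℤ) (w : List (B × Bool)) :
    f (walkEval θ c i w) = walkEval θ (f ∘ c) i w := by
  induction w generalizing i with
  | nil => simp [walkEval]
  | cons l u ih => simp [walkEval, ih, apply_ite f]

theorem walkEval_const (ψ : B → P) (i : ℤ) (w : List (B × Bool)) :
    walkEval θ (fun e => ψ e.1) i w = FreeGroup.lift ψ (FreeGroup.mk w) := by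
  rw [FreeGroup.lift_mk]
  induction w generalizing i with
  | nil => simp [walkEval]
  | cons l u ih =>
    obtain ⟨b, _ | _⟩ := l <;> simp [walkEval, ih, letterEdge]

/-- The edge `e` is traversed exactly once by the path spelled by `R` from the vertex `0`. -/
def IsPivot (θ : B → ℤ) (R : List (B × Bool)) (e : B × ℤ) : Prop :=
  ∃ U l V, R = U ++ l :: V ∧ letterEdge θ (walkEnd θ 0 U) l = e ∧
    e ∉ walkEdges θ 0 U ∧ e ∉ walkEdges θ (letterNext θ (walkEnd θ 0 U) l) V

variable {θ} {R : List (B × Bool)}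

theorem IsPivot.mem {e : B × ℤ} (h : IsPivot θ R e) : e ∈ walkEdges θ 0 R := by
  obtain ⟨U, l, V, rfl, rfl, -, -⟩ := h
  simp [walkEdges_append, walkEdges]

theorem IsPivot.bijective [DecidableEq B] {e : B × ℤ} (h : IsPivot θ R e) (c : B × ℤ → P)
    (i : ℤ) :
    Function.Bijective fun y => walkEval θ (Function.update c (e.1, e.2 + i) y) i R := by
  obtain ⟨U, l, V, rfl, he, hU, hV⟩ := h
  have key : ∀ y, walkEval θ (Function.update c (e.1, e.2 + i) y) i (U ++ l :: V) =
      walkEval θ c i U * ((if l.2 then y else y⁻¹) *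
        walkEval θ c (letterNext θ (walkEnd θ i U) l) V) := by
    intro y
    have h1 : walkEnd θ i U = walkEnd θ 0 U + i := by
      simpa using walkEnd_add θ 0 i U
    have h2 : letterEdge θ (walkEnd θ i U) l = (e.1, e.2 + i) := by
      rw [h1, letterEdge_add, he]
    have h3 : walkEval θ (Function.update c (e.1, e.2 + i) y) i U = walkEval θ c i U := by
      refine walkEval_congr θ fun a ha => Function.update_of_ne ?_ _ _
      rintro rfl
      rw [mem_walkEdges] at ha
      simp at ha
      exact hU ha
    have h4 : walkEval θ (Function.update c (e.1, e.2 + i) y)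
        (letterNext θ (walkEnd θ i U) l) V =
          walkEval θ c (letterNext θ (walkEnd θ i U) l) V := by
      refine walkEval_congr θ fun a ha => Function.update_of_ne ?_ _ _
      rintro rfl
      rw [h1, letterNext_add, mem_walkEdges_add] at ha
      simp at ha
      exact hV ha
    rw [walkEval_append, walkEval, h2, h3, h4, Function.update_self]
  simp only [key]
  refine (Group.mulLeft_bijective _).comp ((Group.mulRight_bijective _).comp ?_)
  split
  · exact Function.bijective_id
  · exact inv_involutive.bijective

/-- If every translate of `R` starting in an interval has a pivot lying strictly to the right of the
earlier translates, then the pivot labels can be traded for the values of the translates of `R`. -/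
theorem existsUnique_labelling {e : B × ℤ} (h : IsPivot θ R e)
    (hlast : ∀ i < 0, e ∉ walkEdges θ i R) (a : ℤ) (N : ℕ) (f : B × ℤ → P) :
    ∃! c : B × ℤ → P, (∀ e', (∀ j < N, e' ≠ (e.1, e.2 + (a + j))) → c e' = f e') ∧
      ∀ j < N, walkEval θ c (a + j) R = f (e.1, e.2 + (a + j)) := by
  classical
  have hlast' : ∀ c : B × ℤ → P, ∀ (k : ℤ) (y : P), ∀ i < k,
      walkEval θ (Function.update c (e.1, e.2 + k) y) i R = walkEval θ c i R := by
    intro c k y i hik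
    refine walkEval_congr θ fun e' he' => Function.update_of_ne ?_ _ _
    rintro rfl
    have := (mem_walkEdges θ).1 he'
    apply hlast (i - k) (by linarith)
    rw [mem_walkEdges]
    convert this using 2
    ring
  induction N with
  | zero => exact ⟨f, by simp, fun c hc => funext fun e' => hc.1 e' (by simp)⟩
  | succ N ih =>
    obtain ⟨c, ⟨hc1, hc2⟩, hc3⟩ := ih
    obtain ⟨y, hy⟩ := (h.bijective c (a + N)).2 (f (e.1, e.2 + (a + N)))
    refine ⟨Function.update c (e.1, e.2 + (a + N)) y, ⟨?_, ?_⟩, ?_⟩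
    · intro e' he'
      rw [Function.update_of_ne (he' N (by simp))]
      exact hc1 e' fun j hj => he' j (by omega)
    · intro j hj
      rcases Nat.lt_succ_iff_lt_or_eq.1 hj with hj | rfl
      · rw [hlast' _ _ _ _ (by omega), hc2 j hj]
      · exact hy
    · rintro c' ⟨hc1', hc2'⟩
      have h0 : Function.update c' (e.1, e.2 + (a + N)) (f (e.1, e.2 + (a + N))) = c := by
        refine hc3 _ ⟨fun e' he' => ?_, fun j hj => ?_⟩
        · by_cases hN : e' = (e.1, e.2 + (a + N))
          · rw [hN, Function.update_self]
          · rw [Function.update_of_ne hN]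
            refine hc1' e' fun j hj => ?_
            rcases Nat.lt_succ_iff_lt_or_eq.1 hj with hj | rfl
            · exact he' j hj
            · exact hN
        · rw [hlast' _ _ _ _ (by omega), hc2' j (by omega)]
      have h1 : c' = Function.update c (e.1, e.2 + (a + N)) (c' (e.1, e.2 + (a + N))) := by
        rw [← h0]; simp
      have h2 : c' (e.1, e.2 + (a + N)) = y := by
        apply (h.bijective c (a + N)).1
        simp only
        rw [← h1, hc2' N (by simp)]
        exact hy.symm
      rw [h1, h2]

end Walks

section FiniteQuotients

variable {S Γ : Type*} [Group Γ]

theorem exists_perm_extending_mul (Ω : Set Γ) [Finite Ω] (g : Γ) :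
    ∃ p : Equiv.Perm Ω, ∀ ω : Ω, g * ω ∈ Ω → (p ω : Γ) = g * ω := by
  classical
  have := Fintype.ofFinite Ω
  let e : {ω : Ω // g * ω ∈ Ω} ≃ {ω : Ω // g⁻¹ * ω ∈ Ω} :=
    { toFun := fun ω => ⟨⟨g * ω.1, ω.2⟩, by simp⟩
      invFun := fun ω => ⟨⟨g⁻¹ * ω.1, ω.2⟩, by simp⟩
      left_inv := fun ω => by simp
      right_inv := fun ω => by simp }
  refine ⟨e.extendSubtype, fun ω hω => ?_⟩
  rw [Equiv.extendSubtype_apply_of_mem e ω hω]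
  rfl

theorem exists_perm_extending_mul_of_pow_eq_one (Ω : Set Γ) (g : Γ) (n : ℕ)
    (hg : g ^ n = 1) :
    ∃ p : Equiv.Perm Ω, p ^ n = 1 ∧ ∀ ω : Ω, (∀ a : ℤ, g ^ a * ω ∈ Ω) → (p ω : Γ) = g * ω := by
  classical
  let e : Equiv.Perm {ω : Ω // ∀ a : ℤ, g ^ a * ω ∈ Ω} :=
    { toFun := fun ω => ⟨⟨g * ω.1, by simpa using ω.2 1⟩, fun a => by
        simpa [← mul_assoc, ← zpow_add_one] using ω.2 (a + 1)⟩
      invFun := fun ω => ⟨⟨g⁻¹ * ω.1, by simpa using ω.2 (-1)⟩, fun a => by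
        simpa [← mul_assoc, ← zpow_sub_one] using ω.2 (a - 1)⟩
      left_inv := fun ω => by simp
      right_inv := fun ω => by simp }
  have he : ∀ (k : ℕ) ω, (((e ^ k) ω).1 : Γ) = g ^ k * ω.1 := by
    intro k ω
    induction k with
    | zero => simp
    | succ k ih => rw [pow_succ', Equiv.Perm.mul_apply, pow_succ', mul_assoc, ← ih]; rfl
  refine ⟨Equiv.Perm.ofSubtype e, ?_, fun ω hω => ?_⟩
  · have : e ^ n = 1 := by
      ext ω
      simp [he, hg]
    rw [← map_pow, this, map_one]
  · rw [Equiv.Perm.ofSubtype_apply_of_mem e hω]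
    rfl

/-- Free products of cyclic groups are residually finite. -/
theorem exists_finite_quotient (ψ : S → Γ) (T : Set S) {n : ℕ} (hn : 0 < n)
    (hT : ∀ s ∈ T, ψ s ^ n = 1) (u : FreeGroup S) (hu : FreeGroup.lift ψ u ≠ 1) :
    ∃ (N : ℕ) (f : S → Equiv.Perm (Fin N)), (∀ s ∈ T, f s ^ n = 1) ∧
      FreeGroup.lift f u ≠ 1 := by
  classical
  set L := u.toWord with hL
  have hLu : FreeGroup.mk L = u := FreeGroup.mk_toWord
  let val : List (S × Bool) → Γ := fun w => FreeGroup.lift ψ (FreeGroup.mk w)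
  have hcons : ∀ l w, val (l :: w) = (if l.2 then ψ l.1 else (ψ l.1)⁻¹) * val w := by
    intro l w
    simp only [val, FreeGroup.lift_mk, List.map_cons, List.prod_cons]
    cases l.2 <;> rfl
  let Ω : Set Γ := (fun p : List (S × Bool) × (S × Bool) × ℕ => ψ p.2.1.1 ^ p.2.2 * val p.1) ''
    ({w | w ∈ L.tails} ×ˢ {l | l ∈ L} ×ˢ Set.Iio n)
  have hfin : Finite Ω :=
    (((List.finite_toSet _).prod ((List.finite_toSet _).prod (Set.finite_Iio n))).image _).to_subtype
  have hmem : ∀ w, w <:+ L → ∀ l ∈ L, val w ∈ Ω := fun w hw l hl =>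
    ⟨(w, l, 0), ⟨(List.mem_tails _ _).2 hw, hl, hn⟩, by simp⟩
  have hmemT : ∀ w, w <:+ L → ∀ l ∈ L, l.1 ∈ T → ∀ a : ℤ, ψ l.1 ^ a * val w ∈ Ω := by
    intro w hw l hl hlT a
    have hn' : (0 : ℤ) < n := by exact_mod_cast hn
    obtain ⟨k, hk⟩ := Int.eq_ofNat_of_zero_le (Int.emod_nonneg a hn'.ne')
    have hlt := Int.emod_lt_of_pos a hn'
    refine ⟨(w, l, k), ⟨(List.mem_tails _ _).2 hw, hl, by simp; omega⟩, ?_⟩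
    have : ψ l.1 ^ a = ψ l.1 ^ k := by
      rw [← zpow_natCast, ← hk]
      conv_lhs => rw [← Int.emod_add_mul_ediv a n, zpow_add, zpow_mul, zpow_natCast,
        hT _ hlT, one_zpow, mul_one]
    simp [this]
  have hf : ∀ s, ∃ p : Equiv.Perm Ω, (s ∈ T → p ^ n = 1) ∧ ∀ ω : Ω,
      (if s ∈ T then ∀ a : ℤ, ψ s ^ a * ω ∈ Ω else ψ s * ω ∈ Ω) → (p ω : Γ) = ψ s * ω := by
    intro s
    by_cases hs : s ∈ T
    · obtain ⟨p, hp⟩ := exists_perm_extending_mul_of_pow_eq_one Ω (ψ s) n (hT s hs)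
      exact ⟨p, fun _ => hp.1, by simpa [hs] using hp.2⟩
    · obtain ⟨p, hp⟩ := exists_perm_extending_mul Ω (ψ s)
      exact ⟨p, fun h => (hs h).elim, by simpa [hs] using hp⟩
  choose f hf1 hf2 using hf
  have hLne : L ≠ [] := by
    intro h
    rw [h] at hLu
    rw [← hLu] at hu
    exact hu (by simp)
  obtain ⟨l₀, hl₀⟩ := List.exists_mem_of_ne_nil L hLne
  have h1 : val [] ∈ Ω := hmem [] L.nil_suffix l₀ hl₀
  have hact : ∀ w, w <:+ L → ((FreeGroup.lift f (FreeGroup.mk w) ⟨val [], h1⟩ : Ω) : Γ) = val w := by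
    intro w
    induction w with
    | nil => intro _; simp [FreeGroup.lift_mk]
    | cons l w ih =>
      intro hw
      have hw' : w <:+ L := (List.suffix_cons l w).trans hw
      have hl : l ∈ L := hw.subset (by simp)
      have hval := hmem w hw' l hl
      have hval' := hmem _ hw l hl
      have hrec : FreeGroup.lift f (FreeGroup.mk w) ⟨val [], h1⟩ = ⟨val w, hval⟩ :=
        Subtype.ext (ih hw')
      have hmk : FreeGroup.lift f (FreeGroup.mk (l :: w)) =
          (if l.2 then f l.1 else (f l.1)⁻¹) * FreeGroup.lift f (FreeGroup.mk w) := by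
        simp only [FreeGroup.lift_mk, List.map_cons, List.prod_cons]
        cases l.2 <;> rfl
      rw [hmk, Equiv.Perm.mul_apply, hrec]
      have hc := hcons l w
      by_cases hl2 : l.2
      · simp only [hl2, if_true] at hc ⊢
        rw [hf2, hc]
        split_ifs with hlT
        · exact hmemT w hw' l hl hlT
        · simpa [hc] using hval'
      · simp only [hl2, if_false, Bool.false_eq_true] at hc ⊢
        have : f l.1 ⟨val (l :: w), hval'⟩ = ⟨val w, hval⟩ := by
          apply Subtype.ext
          rw [hf2]
          · simp [hc]
          · split_ifs with hlT
            · exact hmemT _ hw l hl hlT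
            · simpa [hc] using hval
        rw [← this]
        simp
  obtain ⟨N, ⟨φ⟩⟩ := Finite.exists_equiv_fin Ω
  refine ⟨N, fun s => φ.permCongrHom (f s), fun s hs => ?_, fun h => hu ?_⟩
  · rw [← map_pow, hf1 s hs, map_one]
  · have h2 : FreeGroup.lift f u = 1 := by
      apply φ.permCongrHom.injective
      rw [map_one, ← h]
      exact DFunLike.congr_fun (FreeGroup.ext_hom (φ.permCongrHom.toMonoidHom.comp
        (FreeGroup.lift f)) (FreeGroup.lift fun s => φ.permCongrHom (f s))
        fun a => by simp) u
    have h3 := hact L List.suffix_rfl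
    rw [hLu, h2] at h3
    simp only [Equiv.Perm.coe_one, id, val, hLu] at h3
    rw [← h3]
    simp [FreeGroup.lift_mk]

end FiniteQuotients

section Windows

variable {B P Γ : Type*}

/-- `R` spells a closed path from `0` with range `[mn, mx]`, traversing exactly once some edge `top`
ending at `mx` and some edge `bot` starting at `mn`. -/
structure IsMaxMinWord (θ : B → ℤ) (R : List (B × Bool)) (mn mx : ℤ) (top bot : B × ℤ) :
    Prop where
  closed : walkEnd θ 0 R = 0
  range : ∀ e ∈ walkEdges θ 0 R, mn ≤ e.2 ∧ e.2 ≤ mx ∧ mn ≤ e.2 + θ e.1 ∧ e.2 + θ e.1 ≤ mx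
  top_pivot : IsPivot θ R top
  max_top : max top.2 (top.2 + θ top.1) = mx
  bot_pivot : IsPivot θ R bot
  min_bot : min bot.2 (bot.2 + θ bot.1) = mn

/-- The edge `e` has its letter in `S` and both ends in `[0, q]`. -/
def InWindow (S : Set B) (θ : B → ℤ) (q : ℤ) (e : B × ℤ) : Prop :=
  e.1 ∈ S ∧ 0 ≤ e.2 ∧ e.2 ≤ q ∧ 0 ≤ e.2 + θ e.1 ∧ e.2 + θ e.1 ≤ q

/-- The labelling `c` is supported in the window `[0, q]` and satisfies the relators `R ^ n` read
inside the window. -/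
def IsWindowSol [Group P] (S : Set B) (θ : B → ℤ) (R : List (B × Bool)) (n : ℕ) (mn mx q : ℤ)
    (c : B × ℤ → P) : Prop :=
  (∀ e, ¬InWindow S θ q e → c e = 1) ∧
    ∀ i, 0 ≤ i + mn → i + mx ≤ q → walkEval θ c i R ^ n = 1

variable {S : Set B} {θ : B → ℤ} {R : List (B × Bool)} {n : ℕ} {mn mx q : ℤ} {top bot : B × ℤ}

theorem IsMaxMinWord.range_add (h : IsMaxMinWord θ R mn mx top bot) {i : ℤ} {e : B × ℤ}
    (he : e ∈ walkEdges θ i R) :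
    i + mn ≤ e.2 ∧ e.2 ≤ i + mx ∧ i + mn ≤ e.2 + θ e.1 ∧ e.2 + θ e.1 ≤ i + mx := by
  have := h.range _ ((mem_walkEdges θ).1 he)
  simp only at this
  omega

theorem IsMaxMinWord.walkEnd_eq (h : IsMaxMinWord θ R mn mx top bot) (i : ℤ) :
    walkEnd θ i R = i := by
  have := walkEnd_add θ 0 i R
  rwa [h.closed, zero_add] at this

theorem IsMaxMinWord.exists_finite_labelling [Group Γ] (h : IsMaxMinWord θ R mn mx top bot)
    (hn : 0 < n) (ψ : B → Γ) (hR : FreeGroup.lift ψ (FreeGroup.mk R) ^ n = 1)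
    (w : List (B × Bool)) (hw : FreeGroup.lift ψ (FreeGroup.mk w) ≠ 1) (i a : ℤ) (N : ℕ) :
    ∃ (K : ℕ) (c : B × ℤ → Equiv.Perm (Fin K)),
      (∀ j < N, walkEval θ c (a + j) R ^ n = 1) ∧ walkEval θ c i w ≠ 1 := by
  classical
  have hlast : ∀ i < 0, top ∉ walkEdges θ i R := by
    intro i hi hmem
    have h1 := h.range_add hmem
    have h2 := h.max_top
    omega
  let T : Set (B × ℤ) := {e | ∃ j < N, e = (top.1, top.2 + (a + j))}
  obtain ⟨χ, ⟨hχ1, hχ2⟩, -⟩ :=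
    existsUnique_labelling h.top_pivot hlast a N (FreeGroup.of (α := B × ℤ))
  let f : B × ℤ → Γ := fun e => if e ∈ T then FreeGroup.lift ψ (FreeGroup.mk R) else ψ e.1
  have hfT : ∀ j < N, f (top.1, top.2 + (a + j)) = FreeGroup.lift ψ (FreeGroup.mk R) :=
    fun j hj => if_pos ⟨j, hj, rfl⟩
  have hχψ : FreeGroup.lift f ∘ χ = fun e => ψ e.1 := by
    refine (existsUnique_labelling h.top_pivot hlast a N f).unique ⟨?_, ?_⟩ ⟨?_, ?_⟩
    · intro e he
      simp [hχ1 e he]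
    · intro j hj
      rw [← map_walkEval, hχ2 j hj, FreeGroup.lift_apply_of]
    · intro e he
      have : e ∉ T := by
        rintro ⟨j, hj, rfl⟩
        exact he j hj rfl
      simp [f, this]
    · intro j hj
      rw [walkEval_const, hfT j hj]
  obtain ⟨K, g, hg1, hg2⟩ := exists_finite_quotient f T hn
    (by rintro _ ⟨j, hj, rfl⟩; rw [hfT j hj, hR]) (walkEval θ χ i w)
    (by rwa [map_walkEval, hχψ, walkEval_const])
  refine ⟨K, FreeGroup.lift g ∘ χ, fun j hj => ?_, ?_⟩
  · rw [← map_walkEval, hχ2 j hj, FreeGroup.lift_apply_of]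
    exact hg1 _ ⟨j, hj, rfl⟩
  · rwa [← map_walkEval]

theorem finite_inWindow (hS : S.Finite) : {e | InWindow S θ q e}.Finite :=
  (hS.prod (Set.finite_Icc 0 q)).subset fun _ he => ⟨he.1, he.2.1, he.2.2.1⟩

theorem finite_isWindowSol [Group P] [Finite P] (hS : S.Finite) :
    Finite {c : B × ℤ → P // IsWindowSol S θ R n mn mx q c} := by
  have := (finite_inWindow (θ := θ) (q := q) hS).to_subtype
  refine Finite.of_injective
    (fun c (e : {e | InWindow S θ q e}) => c.1 e.1) fun c c' hcc => Subtype.ext (funext fun e => ?_)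
  by_cases he : InWindow S θ q e
  · exact congrFun hcc ⟨e, he⟩
  · rw [c.2.1 e he, c'.2.1 e he]

/-- Solutions on a window can be shifted by one step, injectively: the labels lost at the bottom
are recorded in the free labels gained at the top. -/
theorem IsMaxMinWord.exists_injective_shift [Group P] (h : IsMaxMinWord θ R mn mx top bot)
    (hRS : ∀ l ∈ R, l.1 ∈ S) (hθ : ∀ b ∈ S, |θ b| < q) (hq : mx - mn ≤ q) :
    ∃ next : {c : B × ℤ → P // IsWindowSol S θ R n mn mx q c} →
        {c : B × ℤ → P // IsWindowSol S θ R n mn mx q c},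
      Function.Injective next ∧
        ∀ c e, InWindow S θ (q - 1) e → (next c).1 e = c.1 (e.1, e.2 + 1) := by
  classical
  have hS : ∀ {i e}, e ∈ walkEdges θ i R → e.1 ∈ S := fun he => by
    obtain ⟨l, hl, hle⟩ := List.mem_map.1 (fst_mem_of_mem_walkEdges θ he)
    exact hle ▸ hRS l hl
  have htopS := hS h.top_pivot.mem
  have hbotS := hS h.bot_pivot.mem
  have htop := h.max_top
  have hbot := h.min_bot
  have hrt := h.range _ h.top_pivot.mem
  obtain ⟨x, s⟩ := top
  obtain ⟨y, t⟩ := bot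
  simp only at htopS hbotS htop hbot hrt
  have hσS : ∀ b, Equiv.swap x y b ∈ S ↔ b ∈ S := by
    intro b
    rw [Equiv.swap_apply_def]
    split_ifs with h1 h2
    · simp [h1, htopS, hbotS]
    · simp [h2, htopS, hbotS]
    · rfl
  let F : (B × ℤ → P) → B → P := fun c b =>
    if b = y then walkEval θ c (-mn) R else c (b, max 0 (-θ b))
  let base : (B × ℤ → P) → B × ℤ → P := fun c e =>
    if InWindow S θ (q - 1) e then c (e.1, e.2 + 1)
    else if e.1 ∈ S ∧ e.2 = q - max 0 (θ e.1) then F c (Equiv.swap x y e.1) else 1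
  have hsol : ∀ c : B × ℤ → P, ∃ v, walkEval θ
      (Function.update (base c) (x, s + (q - mx)) v) (q - mx) R = walkEval θ c (-mn) R :=
    fun c => (h.top_pivot.bijective (base c) (q - mx)).2 _
  choose v hv using hsol
  let nxt : (B × ℤ → P) → B × ℤ → P := fun c => Function.update (base c) (x, s + (q - mx)) (v c)
  have hshift : ∀ c e, InWindow S θ (q - 1) e → nxt c e = c (e.1, e.2 + 1) := by
    intro c e he
    have : e ≠ (x, s + (q - mx)) := by
      rintro rfl
      simp only [InWindow] at he
      omega
    simp only [nxt, Function.update_of_ne this, base, if_pos he]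
  have hnew : ∀ c, ∀ b ∈ S, b ≠ y →
      nxt c (Equiv.swap x y b, q - max 0 (θ (Equiv.swap x y b))) = c (b, max 0 (-θ b)) := by
    intro c b hb hby
    have hne : (Equiv.swap x y b, q - max 0 (θ (Equiv.swap x y b))) ≠ (x, s + (q - mx)) := by
      intro heq
      apply hby
      have := congrArg (Equiv.swap x y) (congrArg Prod.fst heq)
      simpa using this
    have hwin : ¬ InWindow S θ (q - 1)
        (Equiv.swap x y b, q - max 0 (θ (Equiv.swap x y b))) := by
      simp only [InWindow]
      omega
    simp only [nxt, Function.update_of_ne hne, base, if_neg hwin, hσS, hb, Equiv.swap_apply_self,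
      F, hby]
    simp
  have hmem : ∀ c, IsWindowSol S θ R n mn mx q c → IsWindowSol S θ R n mn mx q (nxt c) := by
    rintro c ⟨hc1, hc2⟩
    refine ⟨fun e he => ?_, fun i hi1 hi2 => ?_⟩
    · have hne : e ≠ (x, s + (q - mx)) := by
        rintro rfl
        apply he
        refine ⟨htopS, ?_⟩
        simp only
        omega
      have h1 : ¬ InWindow S θ (q - 1) e := fun h' => he ⟨h'.1, by have := h'.2; omega⟩
      have h2 : ¬ (e.1 ∈ S ∧ e.2 = q - max 0 (θ e.1)) := by
        rintro ⟨h3, h4⟩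
        have := hθ _ h3
        rw [abs_lt] at this
        exact he ⟨h3, by omega⟩
      simp only [nxt, Function.update_of_ne hne, base, if_neg h1, if_neg h2]
    · rcases hi2.lt_or_eq with hi2 | hi2
      · rw [walkEval_congr_add (t := 1) (c' := c) θ]
        · exact hc2 _ (by omega) (by omega)
        · intro e he
          have := h.range_add he
          exact hshift c e ⟨hS he, by omega⟩
      · obtain rfl : i = q - mx := by omega
        rw [hv]
        exact hc2 _ (by omega) (by omega)
  refine ⟨fun c => ⟨nxt c.1, hmem _ c.2⟩, ?_, fun c e he => hshift c.1 e he⟩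
  rintro ⟨c, hc⟩ ⟨c', hc'⟩ hcc
  replace hcc : nxt c = nxt c' := congrArg Subtype.val hcc
  have hval : walkEval θ c (-mn) R = walkEval θ c' (-mn) R := by
    rw [← hv c, ← hv c']
    exact congrArg (fun d => walkEval θ d (q - mx) R) hcc
  have hagree : ∀ e, e ≠ (y, t + -mn) → c e = c' e := by
    intro e he
    by_cases hwin : InWindow S θ q e
    · by_cases hlow : InWindow S θ (q - 1) (e.1, e.2 - 1)
      · have h1 := hshift c _ hlow
        have h2 := hshift c' _ hlow
        simp only [sub_add_cancel] at h1 h2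
        rw [← h1, ← h2, hcc]
      · have hlo : e.2 = max 0 (-θ e.1) := by
          simp only [InWindow] at hlow hwin
          by_contra hcon
          exact hlow ⟨hwin.1, by omega⟩
        have hey : e.1 ≠ y := by
          intro hey
          apply he
          ext
          · exact hey
          · rw [hlo, hey]
            simp only
            omega
        have h1 := hnew c e.1 hwin.1 hey
        have h2 := hnew c' e.1 hwin.1 hey
        rw [← hlo] at h1 h2
        change _ = c e at h1
        change _ = c' e at h2
        rw [← h1, ← h2, hcc]
    · rw [hc.1 e hwin, hc'.1 e hwin]
  have hupd : c' = Function.update c (y, t + -mn) (c' (y, t + -mn)) := by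
    funext e
    by_cases he : e = (y, t + -mn)
    · rw [he, Function.update_self]
    · rw [Function.update_of_ne he, hagree e he]
  have hlast : c' (y, t + -mn) = c (y, t + -mn) := by
    apply (h.bot_pivot.bijective c (-mn)).1
    simp only
    rw [← hupd, Function.update_eq_self, hval]
  apply Subtype.ext
  simp only
  rw [hupd, hlast, Function.update_eq_self]

/-- Every solution on a large window extends to a periodic solution on the whole line. -/
theorem IsMaxMinWord.exists_periodic [Group P] [Finite P] (h : IsMaxMinWord θ R mn mx top bot)
    (hS : S.Finite) (hRS : ∀ l ∈ R, l.1 ∈ S) (hθ : ∀ b ∈ S, |θ b| < q) (hq : mx - mn ≤ q)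
    {c : B × ℤ → P} (hc : IsWindowSol S θ R n mn mx q c) :
    ∃ (m : ℕ) (μ : B × ℤ → P), 0 < m ∧ (∀ b i, μ (b, i + m) = μ (b, i)) ∧
      (∀ i, walkEval θ μ i R ^ n = 1) ∧ ∀ e, InWindow S θ q e → μ e = c e := by
  obtain ⟨next, hinj, hnext⟩ := h.exists_injective_shift (P := P) (n := n) hRS hθ hq
  have := finite_isWindowSol (P := P) (θ := θ) (R := R) (n := n) (mn := mn) (mx := mx) (q := q) hS
  let π : Equiv.Perm {c : B × ℤ → P // IsWindowSol S θ R n mn mx q c} :=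
    Equiv.ofBijective next (Finite.injective_iff_bijective.1 hinj)
  let E : ℤ → {c : B × ℤ → P // IsWindowSol S θ R n mn mx q c} := fun t => (π ^ t) ⟨c, hc⟩
  have hE : ∀ t, E (t + 1) = next (E t) := by
    intro t
    simp only [E]
    rw [add_comm, zpow_one_add, Equiv.Perm.mul_apply]
    rfl
  let lo : B × ℤ → ℤ := fun e => min e.2 (e.2 + θ e.1)
  let μ : B × ℤ → P := fun e => (E (lo e)).1 (e.1, e.2 - lo e)
  have hμ : ∀ e (k : ℕ), InWindow S θ q (e.1, e.2 - (lo e - k)) →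
      (E (lo e - k)).1 (e.1, e.2 - (lo e - k)) = μ e := by
    intro e k
    induction k with
    | zero => simp [μ]
    | succ k ih =>
      intro hk
      have hlo : lo e = min e.2 (e.2 + θ e.1) := rfl
      simp only [InWindow] at hk ih
      push_cast at hk ⊢
      rw [← ih ⟨hk.1, by omega⟩]
      have h1 := hnext (E (lo e - (k + 1))) (e.1, e.2 - (lo e - k)) ⟨hk.1, by simp only; omega⟩
      rw [← hE] at h1
      have h2 : lo e - (k + 1) + 1 = lo e - (k : ℤ) := by ring
      have h3 : e.2 - (lo e - k) + 1 = e.2 - (lo e - (k + 1 : ℤ)) := by ring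
      rw [h2] at h1
      simp only [h3] at h1
      exact h1.symm
  have hμ' : ∀ e t, InWindow S θ q (e.1, e.2 - t) → (E t).1 (e.1, e.2 - t) = μ e := by
    intro e t ht
    have hlo : lo e = min e.2 (e.2 + θ e.1) := rfl
    obtain ⟨k, hk⟩ : ∃ k : ℕ, lo e - t = k :=
      Int.eq_ofNat_of_zero_le (by simp only [InWindow] at ht; omega)
    obtain rfl : t = lo e - k := by omega
    exact hμ e k ht
  refine ⟨orderOf π, μ, orderOf_pos π, fun b i => ?_, fun i => ?_, fun e he => ?_⟩
  · have h1 : lo (b, i + orderOf π) = lo (b, i) + orderOf π := by simp only [lo]; omega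
    have h2 : E (lo (b, i) + orderOf π) = E (lo (b, i)) := by
      simp only [E, zpow_add, zpow_natCast, pow_orderOf_eq_one, mul_one]
    simp only [μ, h1, h2, add_sub_add_right_eq_sub]
  · rw [walkEval_congr_add (t := -(i + mn)) (c' := (E (i + mn)).1) θ]
    · exact (E (i + mn)).2.2 _ (by omega) (by omega)
    · intro e he
      have h1 := h.range_add he
      rw [← sub_eq_add_neg]
      obtain ⟨l, hl, hle⟩ := List.mem_map.1 (fst_mem_of_mem_walkEdges θ he)
      exact (hμ' e _ ⟨hle ▸ hRS l hl, by simp only; omega⟩).symm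
  · have := hμ' e 0 (by simpa using he)
    simpa [E] using this.symm

end Windows

section Action

variable {B P : Type*} [Group P] {m : ℕ}

/-- The permutation of `ℤ/m × P` induced by the letter `b`, for an `m`-periodic labelling. -/
def periodicPerm (θ : B → ℤ) (μ : B × ℤ → P) (m : ℕ) (b : B) : Equiv.Perm (ZMod m × P) where
  toFun z := (z.1 + θ b, z.2 * μ (b, z.1.val))
  invFun z := (z.1 - θ b, z.2 * (μ (b, (z.1 - θ b : ZMod m).val))⁻¹)
  left_inv z := by simp
  right_inv z := by simp

variable {θ : B → ℤ} {μ : B × ℤ → P}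

theorem periodicPerm_apply [NeZero m] (hμ : ∀ b i, μ (b, i + m) = μ (b, i)) (b : B) (i : ℤ)
    (p : P) : periodicPerm θ μ m b (i, p) = (((i + θ b : ℤ) : ZMod m), p * μ (b, i)) := by
  have hper : Function.Periodic (fun i => μ (b, i)) (m : ℤ) := fun i => hμ b i
  have h : μ (b, i % (m : ℤ)) = μ (b, i) := by
    have := hper.sub_int_mul_eq (x := i) (i / m)
    rw [← this, Int.emod_def]
    simp [mul_comm]
  simp only [periodicPerm, Equiv.coe_fn_mk, ZMod.val_intCast, h, Int.cast_add]

/-- The walk labels of a periodic labelling are realised by an action on `ℤ/m × P`, written on the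
right. -/
theorem lift_periodicPerm_apply [NeZero m] (hμ : ∀ b i, μ (b, i + m) = μ (b, i))
    (w : List (B × Bool)) (i : ℤ) (p : P) :
    (FreeGroup.lift (fun b => MulOpposite.op (periodicPerm θ μ m b)) (FreeGroup.mk w)).unop
      ((i : ZMod m), p) = ((walkEnd θ i w : ZMod m), p * walkEval θ μ i w) := by
  rw [FreeGroup.lift_mk]
  induction w generalizing i p with
  | nil => simp [walkEnd, walkEval]
  | cons l w ih =>
    obtain ⟨b, _ | _⟩ := l
    · have : (periodicPerm θ μ m b)⁻¹ ((i : ZMod m), p) =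
          (((i - θ b : ℤ) : ZMod m), p * (μ (b, i - θ b))⁻¹) := by
        rw [Equiv.Perm.inv_eq_iff_eq, periodicPerm_apply hμ]
        simp
      simp only [List.map_cons, List.prod_cons, cond_false, MulOpposite.unop_mul,
        MulOpposite.unop_inv, MulOpposite.unop_op, Equiv.Perm.mul_apply, this, ih]
      simp [walkEnd, walkEval, letterNext, letterEdge, mul_assoc]
    · simp only [List.map_cons, List.prod_cons, cond_true, MulOpposite.unop_mul,
        MulOpposite.unop_op, Equiv.Perm.mul_apply, periodicPerm_apply hμ, ih]
      simp [walkEnd, walkEval, letterNext, letterEdge, mul_assoc]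

/-- A word with the max-min property, raised to a positive power, defines a residually finite
one-relator group. -/
theorem IsMaxMinWord.exists_finite_hom {Γ : Type*} [Group Γ] {R : List (B × Bool)} {n : ℕ}
    {mn mx : ℤ} {top bot : B × ℤ} (h : IsMaxMinWord θ R mn mx top bot) (hn : 0 < n) (ψ : B → Γ)
    (hR : FreeGroup.lift ψ (FreeGroup.mk R) ^ n = 1) (w : List (B × Bool))
    (hw : FreeGroup.lift ψ (FreeGroup.mk w) ≠ 1) :
    ∃ (G : Type) (_ : Group G) (_ : Finite G) (f : B → G),
      FreeGroup.lift f (FreeGroup.mk R) ^ n = 1 ∧ FreeGroup.lift f (FreeGroup.mk w) ≠ 1 := by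
  classical
  let S : Set B := {b | b ∈ (R ++ w).map Prod.fst}
  have hS : S.Finite := List.finite_toSet _
  obtain ⟨M, hM⟩ := (hS.image fun b => |θ b|).bddAbove
  replace hM : ∀ b ∈ S, |θ b| ≤ M := fun b hb => hM ⟨b, hb, rfl⟩
  obtain ⟨K, hK⟩ := ((List.finite_toSet (walkEdges θ 0 w)).image fun e =>
    max |e.2| |e.2 + θ e.1|).bddAbove
  replace hK : ∀ e ∈ walkEdges θ 0 w, max |e.2| |e.2 + θ e.1| ≤ K := fun e he => hK ⟨e, he, rfl⟩
  obtain ⟨q, hq1, hq2, hq3⟩ : ∃ q : ℤ, M < q ∧ 2 * K ≤ q ∧ mx - mn ≤ q :=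
    ⟨max (M + 1) (max (2 * K) (mx - mn)), by omega, by omega, by omega⟩
  have hRS : ∀ l ∈ R, l.1 ∈ S := fun l hl =>
    List.mem_map.2 ⟨l, List.mem_append_left _ hl, rfl⟩
  have hwin : ∀ e ∈ walkEdges θ K w, InWindow S θ q e := by
    intro e he
    have h1 := hK _ ((mem_walkEdges θ).1 he)
    simp only [max_le_iff, abs_le] at h1
    refine ⟨?_, by omega⟩
    have := fst_mem_of_mem_walkEdges θ he
    simp only [S, List.map_append, List.mem_append, Set.mem_ofPred_eq]
    exact Or.inr this
  obtain ⟨k, c, hc1, hc2⟩ :=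
    h.exists_finite_labelling hn ψ hR w hw K (-mn) (q - mx + mn + 1).toNat
  have hsol : IsWindowSol S θ R n mn mx q fun e => if InWindow S θ q e then c e else 1 := by
    refine ⟨fun e he => if_neg he, fun i hi1 hi2 => ?_⟩
    rw [walkEval_congr (c' := c) θ]
    · have := hc1 (i + mn).toNat (by omega)
      rwa [Int.toNat_of_nonneg hi1, neg_add_cancel_comm_assoc] at this
    · intro e he
      have h1 := h.range_add he
      obtain ⟨l, hl, hle⟩ := List.mem_map.1 (fst_mem_of_mem_walkEdges θ he)
      exact if_pos ⟨hle ▸ hRS l hl, by omega⟩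
  obtain ⟨m, μ, hm, hμ, hμR, hμc⟩ :=
    h.exists_periodic hS hRS (fun b hb => (hM b hb).trans_lt hq1) hq3 hsol
  have : NeZero m := ⟨hm.ne'⟩
  refine ⟨(Equiv.Perm (ZMod m × Equiv.Perm (Fin k)))ᵐᵒᵖ, inferInstance,
    Finite.of_equiv _ MulOpposite.opEquiv, fun b => MulOpposite.op (periodicPerm θ μ m b), ?_, fun hcon => hc2 ?_⟩
  · apply MulOpposite.unop_injective
    ext1 ⟨z, p⟩
    obtain ⟨i, rfl⟩ := ZMod.intCast_surjective z
    have hpow : ∀ a : ℕ, ((FreeGroup.lift (fun b => MulOpposite.op (periodicPerm θ μ m b))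
        (FreeGroup.mk R)).unop ^ a) ((i : ZMod m), p) =
          ((i : ZMod m), p * walkEval θ μ i R ^ a) := by
      intro a
      induction a with
      | zero => simp
      | succ a ih =>
        rw [pow_succ', Equiv.Perm.mul_apply, ih, lift_periodicPerm_apply hμ, h.walkEnd_eq,
          pow_succ, mul_assoc]
    rw [MulOpposite.unop_pow, hpow, hμR]
    simp
  · have h1 := lift_periodicPerm_apply (θ := θ) hμ w K 1
    rw [hcon] at h1
    have h2 := congrArg Prod.snd h1
    simp only [MulOpposite.unop_one, Equiv.Perm.coe_one, id, one_mul] at h2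
    rw [h2]
    refine walkEval_congr θ fun e he => ?_
    rw [hμc e (hwin e he), if_pos (hwin e he)]

end Action

section Flatten

theorem letterEdge_ends {B : Type*} (θ : B → ℤ) (i : ℤ) (l : B × Bool) :
    ((letterEdge θ i l).2 = i ∧ (letterEdge θ i l).2 + θ l.1 = letterNext θ i l) ∨
      ((letterEdge θ i l).2 = letterNext θ i l ∧ (letterEdge θ i l).2 + θ l.1 = i) := by
  unfold letterEdge letterNext
  split <;> simp

variable {X A : Type*}

/-- The extension of a weight by zero on the coefficient letters. -/
abbrev extendWeight (A : Type*) (θ : X → ℤ) : X ⊕ A → ℤ := Sum.elim θ fun _ => 0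

variable (θ : X → ℤ)

theorem phiW_cons_succ (p : X × Bool) (W : List (X × Bool)) (j : ℕ) :
    phiW θ (p :: W) (j + 1) = (if p.2 then θ p.1 else -θ p.1) + phiW θ W j := by
  simp [phiW]

theorem phiW_zero (W : List (X × Bool)) : phiW θ W 0 = 0 := by simp [phiW]

theorem phiW_take (W : List (X × Bool)) {j k : ℕ} (h : j ≤ k) :
    phiW θ (W.take k) j = phiW θ W j := by
  simp [phiW, List.take_take, min_eq_left h]

theorem phiW_add (W : List (X × Bool)) (j k : ℕ) :
    phiW θ W (k + j) = phiW θ W k + phiW θ (W.drop k) j := by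
  simp [phiW, List.take_add]

theorem phiW_succ_s6 (W : List (X × Bool)) {j : ℕ} (h : j < W.length) :
    phiW θ W (j + 1) = phiW θ W j + if W[j].2 then θ W[j].1 else -θ W[j].1 := by
  rw [phiW_add]
  simp [phiW, List.take_one_drop_eq_of_lt_length h]

theorem letterNext_extendWeight (i : ℤ) (p : X × Bool) :
    letterNext (extendWeight A θ) i (Sum.inl p.1, p.2) =
      i + if p.2 then θ p.1 else -θ p.1 := by
  simp only [letterNext, Sum.elim_inl]
  split <;> ring

theorem walkEnd_map_inr (i : ℤ) (u : List (A × Bool)) :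
    walkEnd (extendWeight A θ) i (u.map fun p => (Sum.inr p.1, p.2)) = i := by
  induction u with
  | nil => rfl
  | cons p u ih => simp [walkEnd, letterNext, ih]

theorem mem_walkEdges_map_inr {i : ℤ} {u : List (A × Bool)} {e : (X ⊕ A) × ℤ}
    (h : e ∈ walkEdges (extendWeight A θ) i (u.map fun p => (Sum.inr p.1, p.2))) :
    ∃ a, e = (Sum.inr a, i) := by
  induction u with
  | nil => simp [walkEdges] at h
  | cons p u ih =>
    simp only [List.map_cons, walkEdges, letterEdge, letterNext, List.mem_cons, Sum.elim_inr,
      add_zero, sub_zero, ite_self] at h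
    rcases h with rfl | h
    · exact ⟨_, rfl⟩
    · exact ih h

variable {θ} {R : List (X × Bool × FreeGroup A)}

theorem letterEdge_skel_ends {j : ℕ} (hj : j < (skel R).length) {e : (X ⊕ A) × ℤ}
    (he : e = letterEdge (extendWeight A θ) (phiW θ (skel R) j)
      (Sum.inl (skel R)[j].1, (skel R)[j].2)) :
    e.1 = Sum.inl (skel R)[j].1 ∧
      ((e.2 = phiW θ (skel R) j ∧ e.2 + extendWeight A θ e.1 = phiW θ (skel R) (j + 1)) ∨
      (e.2 = phiW θ (skel R) (j + 1) ∧ e.2 + extendWeight A θ e.1 = phiW θ (skel R) j)) := by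
  have h1 := letterEdge_ends (extendWeight A θ) (phiW θ (skel R) j)
    (Sum.inl (skel R)[j].1, (skel R)[j].2)
  rw [letterNext_extendWeight, ← phiW_succ_s6 θ (skel R) hj, ← he] at h1
  have h2 : e.1 = Sum.inl (skel R)[j].1 := by rw [he]; rfl
  exact ⟨h2, by rwa [h2]⟩

/-- The canonical map from the free group on all generators to the free product. -/
def freeGroupToCoprod (X A : Type*) :
    FreeGroup (X ⊕ A) →* Coprod (FreeGroup A) (FreeGroup X) :=
  FreeGroup.lift (Sum.elim (fun x => Coprod.inr (FreeGroup.of x)) fun a =>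
    Coprod.inl (FreeGroup.of a))

theorem freeGroupToCoprod_comp_map_inr :
    (freeGroupToCoprod X A).comp (FreeGroup.map Sum.inr) = Coprod.inl :=
  FreeGroup.ext_hom _ _ fun a => by simp [freeGroupToCoprod]

theorem freeGroupToCoprod_comp_map_inl :
    (freeGroupToCoprod X A).comp (FreeGroup.map Sum.inl) = Coprod.inr :=
  FreeGroup.ext_hom _ _ fun a => by simp [freeGroupToCoprod]

theorem freeGroupToCoprod_surjective : Function.Surjective (freeGroupToCoprod X A) := by
  intro g
  induction g using Coprod.induction_on with
  | inl a => exact ⟨_, DFunLike.congr_fun freeGroupToCoprod_comp_map_inr a⟩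
  | inr x => exact ⟨_, DFunLike.congr_fun freeGroupToCoprod_comp_map_inl x⟩
  | mul g g' hg hg' =>
    obtain ⟨a, rfl⟩ := hg
    obtain ⟨b, rfl⟩ := hg'
    exact ⟨a * b, map_mul _ _ _⟩

variable [DecidableEq A]

/-- The word in the generators `X ⊕ A` spelled by a relator with coefficients in the free group
on `A`. -/
def flattenRel (R : List (X × Bool × FreeGroup A)) : List ((X ⊕ A) × Bool) :=
  R.flatMap fun t => (Sum.inl t.1, t.2.1) :: t.2.2.toWord.map fun p => (Sum.inr p.1, p.2)

theorem flattenRel_cons (t : X × Bool × FreeGroup A) (R : List (X × Bool × FreeGroup A)) :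
    flattenRel (t :: R) =
      (Sum.inl t.1, t.2.1) :: (t.2.2.toWord.map (fun p => (Sum.inr p.1, p.2)) ++ flattenRel R) := by
  simp [flattenRel]

theorem flattenRel_append (R R' : List (X × Bool × FreeGroup A)) :
    flattenRel (R ++ R') = flattenRel R ++ flattenRel R' := by
  simp [flattenRel]

theorem walkEnd_flattenRel (θ : X → ℤ) (i : ℤ) (R : List (X × Bool × FreeGroup A)) :
    walkEnd (extendWeight A θ) i (flattenRel R) = i + phiW θ (skel R) R.length := by
  induction R generalizing i with
  | nil => simp [flattenRel, walkEnd, phiW]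
  | cons t R ih =>
    have h : phiW θ (skel (t :: R)) (t :: R).length = _ :=
      phiW_cons_succ θ (t.1, t.2.1) (skel R) R.length
    rw [flattenRel_cons, walkEnd, walkEnd_append, walkEnd_map_inr, ih,
      letterNext_extendWeight θ i (t.1, t.2.1), h, add_assoc]

theorem mem_walkEdges_flattenRel (θ : X → ℤ) {i : ℤ} {R : List (X × Bool × FreeGroup A)}
    {e : (X ⊕ A) × ℤ} (h : e ∈ walkEdges (extendWeight A θ) i (flattenRel R)) :
    ∃ (j : ℕ) (hj : j < (skel R).length),
      e = letterEdge (extendWeight A θ) (i + phiW θ (skel R) j)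
        (Sum.inl (skel R)[j].1, (skel R)[j].2) ∨
      ∃ a, e = (Sum.inr a, i + phiW θ (skel R) (j + 1)) := by
  induction R generalizing i with
  | nil => simp [flattenRel, walkEdges] at h
  | cons t R ih =>
    have hsk : skel (t :: R) = (t.1, t.2.1) :: skel R := rfl
    rw [flattenRel_cons, walkEdges, walkEdges_append, walkEnd_map_inr,
      letterNext_extendWeight θ i (t.1, t.2.1), List.mem_cons, List.mem_append] at h
    simp only [hsk]
    rcases h with h | h | h
    · exact ⟨0, by simp, Or.inl (by simpa [phiW_zero] using h)⟩
    · obtain ⟨a, rfl⟩ := mem_walkEdges_map_inr θ h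
      exact ⟨0, by simp, Or.inr ⟨a, by simp [phiW_cons_succ, phiW_zero]⟩⟩
    · obtain ⟨j, hj, h⟩ := ih h
      refine ⟨j + 1, by simpa using hj, ?_⟩
      simpa [phiW_cons_succ, add_assoc] using h

theorem isPivot_flattenRel (hadm : IsAdmissible θ (skel R)) (k : Fin (skel R).length)
    (hk : ∀ j : Fin (skel R).length, j ≠ k →
      phiW θ (skel R) (j.1 + 1) ≠ phiW θ (skel R) (k.1 + 1))
    (hne : ((skel R).get k).1 ≠ ((skel R).get (succIdx (skel R) k)).1) :
    IsPivot (extendWeight A θ) (flattenRel R)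
      (letterEdge (extendWeight A θ) (phiW θ (skel R) k)
        (Sum.inl (skel R)[k].1, (skel R)[k].2)) := by
  have hlen : (skel R).length = R.length := List.length_map _
  have hkR : k.1 < R.length := hlen ▸ k.2
  have hget : (skel R)[k.1] = (R[k.1].1, R[k.1].2.1) := by simp [skel]
  have hdistinct : ∀ (j : ℕ) (hj : j < (skel R).length), j ≠ k.1 →
      letterEdge (extendWeight A θ) (phiW θ (skel R) k)
        (Sum.inl (skel R)[k].1, (skel R)[k].2) ≠
      letterEdge (extendWeight A θ) (phiW θ (skel R) j)
        (Sum.inl (skel R)[j].1, (skel R)[j].2) := by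
    intro j hj hjk heq
    obtain ⟨h1, h2⟩ := letterEdge_skel_ends (θ := θ) k.2 rfl
    obtain ⟨h3, h4⟩ := letterEdge_skel_ends (θ := θ) hj rfl
    rw [← heq] at h3 h4
    have hx : (skel R)[k.1].1 = (skel R)[j].1 := Sum.inl_injective (h1.symm.trans h3)
    have hj1 := hk ⟨j, hj⟩ (fun h => hjk (congrArg Fin.val h))
    have hj0 : phiW θ (skel R) j = phiW θ (skel R) (k.1 + 1) := by
      simp only [Fin.getElem_fin] at h2 h4 hj1
      omega
    have hsucc : j = (succIdx (skel R) k).1 := by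
      rcases Nat.eq_zero_or_pos j with rfl | hjpos
      · have hlast : k = ⟨(skel R).length - 1, by omega⟩ := by
          by_contra hcon
          apply hk ⟨(skel R).length - 1, by omega⟩ (Ne.symm hcon)
          simp only [Nat.sub_add_cancel (show 1 ≤ (skel R).length by omega)]
          rw [← hj0, phiW_zero]
          exact hadm
        have : k.1 + 1 = (skel R).length := by
          rw [hlast]
          simp only
          omega
        simp [succIdx, this]
      · have : j = k.1 + 1 := by
          by_contra hcon
          apply hk ⟨j - 1, by omega⟩ (fun h => hcon (by
            have := congrArg Fin.val h
            simp only at this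
            omega))
          simp only [Nat.sub_add_cancel hjpos, hj0]
        simp only [succIdx]
        rw [Nat.mod_eq_of_lt (by omega), this]
    apply hne
    simp only [List.get_eq_getElem, ← hsucc]
    exact hx
  have htake : skel (R.take k) = (skel R).take k := by simp [skel]
  have hdrop : skel (R.drop (k + 1)) = (skel R).drop (k + 1) := by simp [skel]
  have hU : walkEnd (extendWeight A θ) 0 (flattenRel (R.take k)) = phiW θ (skel R) k := by
    rw [walkEnd_flattenRel, htake, phiW_take _ _ (by simp), zero_add,
      List.length_take_of_le hkR.le]
  refine ⟨flattenRel (R.take k), (Sum.inl (skel R)[k].1, (skel R)[k].2),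
    R[k.1].2.2.toWord.map (fun p => (Sum.inr p.1, p.2)) ++ flattenRel (R.drop (k + 1)),
    ?_, ?_, ?_, ?_⟩
  · conv_lhs => rw [← List.take_append_drop k R, List.drop_eq_getElem_cons hkR]
    rw [flattenRel_append, flattenRel_cons]
    simp [hget]
  · rw [hU]
  · intro hmem
    obtain ⟨j, hj, h | ⟨a, h⟩⟩ := mem_walkEdges_flattenRel θ hmem
    · simp only [htake, List.length_take] at hj
      simp only [htake, zero_add, List.getElem_take, phiW_take θ (skel R) (show j ≤ k by omega)] at h
      exact hdistinct j (by omega) (by omega) h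
    · exact absurd (congrArg Prod.fst h) (by simp [letterEdge])
  · rw [hU, letterNext_extendWeight, Fin.getElem_fin, ← phiW_succ_s6 θ (skel R) k.2,
      walkEdges_append, walkEnd_map_inr, List.mem_append]
    rintro (hmem | hmem)
    · obtain ⟨a, h⟩ := mem_walkEdges_map_inr θ hmem
      exact absurd (congrArg Prod.fst h) (by simp [letterEdge])
    · obtain ⟨j, hj, h | ⟨a, h⟩⟩ := mem_walkEdges_flattenRel θ hmem
      · simp only [hdrop, List.length_drop] at hj
        simp only [hdrop, List.getElem_drop, ← phiW_add] at h
        exact hdistinct (k + 1 + j) (by omega) (by omega) h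
      · exact absurd (congrArg Prod.fst h) (by simp [letterEdge])

theorem UniqueMaxMinWith.exists_isMaxMinWord (h : UniqueMaxMinWith θ (skel R)) :
    ∃ mn mx top bot, IsMaxMinWord (extendWeight A θ) (flattenRel R) mn mx top bot := by
  obtain ⟨-, -, -, hadm, k, l, hk, hl, hk', hl'⟩ := h
  have hlen : (skel R).length = R.length := List.length_map _
  have hbound : ∀ j ≤ (skel R).length, phiW θ (skel R) (l.1 + 1) ≤ phiW θ (skel R) j ∧
      phiW θ (skel R) j ≤ phiW θ (skel R) (k.1 + 1) := by
    have hsucc : ∀ j < (skel R).length,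
        phiW θ (skel R) (l.1 + 1) ≤ phiW θ (skel R) (j + 1) ∧
          phiW θ (skel R) (j + 1) ≤ phiW θ (skel R) (k.1 + 1) := by
      intro j hj
      constructor
      · by_cases hjl : (⟨j, hj⟩ : Fin _) = l
        · rw [← hjl]
        · exact (hl _ hjl).le
      · by_cases hjk : (⟨j, hj⟩ : Fin _) = k
        · rw [← hjk]
        · exact (hk _ hjk).le
    rintro (_ | j) hj
    · have := hsucc ((skel R).length - 1) (by have := k.pos; omega)
      rw [Nat.sub_add_cancel k.pos] at this
      rw [phiW_zero]
      rwa [show phiW θ (skel R) (skel R).length = 0 from hadm] at this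
    · exact hsucc j hj
  have hpk := letterEdge_skel_ends (R := R) (θ := θ) k.2 rfl
  have hpl := letterEdge_skel_ends (R := R) (θ := θ) l.2 rfl
  have hbk := hbound k k.2.le
  have hbl := hbound l l.2.le
  refine ⟨phiW θ (skel R) (l.1 + 1), phiW θ (skel R) (k.1 + 1), _, _, ?_, ?_,
    isPivot_flattenRel hadm k (fun j hj => (hk j hj).ne) hk', ?_,
    isPivot_flattenRel hadm l (fun j hj => (hl j hj).ne') hl', ?_⟩
  · rw [walkEnd_flattenRel, ← hlen, zero_add]
    exact hadm
  · intro e he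
    obtain ⟨j, hj, h | ⟨a, h⟩⟩ := mem_walkEdges_flattenRel θ he
    · rw [zero_add] at h
      have h1 := letterEdge_skel_ends hj h
      have h2 := hbound j hj.le
      have h3 := hbound (j + 1) hj
      omega
    · have h3 := hbound (j + 1) hj
      rw [h]
      simp only [Sum.elim_inr, add_zero, zero_add]
      exact ⟨h3.1, h3.2, h3⟩
  · simp only [Fin.getElem_fin]
    omega
  · simp only [Fin.getElem_fin]
    omega

theorem freeGroupToCoprod_mk_flattenRel (R : List (X × Bool × FreeGroup A)) :
    freeGroupToCoprod X A (FreeGroup.mk (flattenRel R)) = relWord R := by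
  induction R with
  | nil => simp [flattenRel, relWord, freeGroupToCoprod]
  | cons t R ih =>
    have h1 : FreeGroup.mk (flattenRel (t :: R)) =
        FreeGroup.map Sum.inl (FreeGroup.mk [(t.1, t.2.1)]) * FreeGroup.map Sum.inr t.2.2 * FreeGroup.mk (flattenRel R) := by
      conv_rhs => rw [← FreeGroup.mk_toWord (x := t.2.2)]
      rw [flattenRel_cons, FreeGroup.map.mk, FreeGroup.map.mk, FreeGroup.mul_mk, FreeGroup.mul_mk]
      simp
    rw [h1, map_mul, map_mul, ih, relWord, relWord, List.map_cons, List.prod_cons,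
      ← freeGroupToCoprod_comp_map_inr, ← freeGroupToCoprod_comp_map_inl]
    rfl

end Flatten

/-- **Theorem 4**, last part (Pride). If `Φ` is a free group and
`P = ⟨x, Φ; R⟩` an `M_Φ`-presentation, then for every `n > 1` the one-relator
group `G_n = ⟨x, Φ; Rⁿ⟩` is residually finite. -/
theorem relGroupPow_residuallyFinite_of_free {X A : Type*}
    (R : List (X × Bool × FreeGroup A)) (hP : HasUniqueMaxMin (skel R)) :
    ∀ n : ℕ, 1 < n → ResiduallyFinite (relGroupPow R n) := by
  classical
  intro n hn g hg
  obtain ⟨θ, hθ⟩ := hP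
  obtain ⟨mn, mx, top, bot, h⟩ := hθ.exists_isMaxMinWord
  let p : Coprod (FreeGroup A) (FreeGroup X) →* relGroupPow R n := QuotientGroup.mk' _
  have hp : p (relWord R) ^ n = 1 := by
    rw [← map_pow]
    exact (QuotientGroup.eq_one_iff _).2 (Subgroup.subset_normalClosure rfl)
  obtain ⟨g', rfl⟩ : ∃ g', p g' = g := QuotientGroup.mk'_surjective _ g
  obtain ⟨u, rfl⟩ := freeGroupToCoprod_surjective g'
  let ψ : X ⊕ A → relGroupPow R n := fun b => p (freeGroupToCoprod X A (FreeGroup.of b))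
  have hψ : FreeGroup.lift ψ = p.comp (freeGroupToCoprod X A) :=
    FreeGroup.ext_hom _ _ fun b => by simp [ψ]
  obtain ⟨Q, hQ, hQfin, f, hfR, hfu⟩ := h.exists_finite_hom (zero_lt_one.trans hn) ψ
    (by rw [hψ, MonoidHom.comp_apply, freeGroupToCoprod_mk_flattenRel, hp]) u.toWord
    (by rw [hψ, FreeGroup.mk_toWord]; exact hg)
  let F : Coprod (FreeGroup A) (FreeGroup X) →* Q :=
    Coprod.lift (FreeGroup.lift (f ∘ Sum.inr)) (FreeGroup.lift (f ∘ Sum.inl))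
  have hF : F.comp (freeGroupToCoprod X A) = FreeGroup.lift f :=
    FreeGroup.ext_hom _ _ fun b => by cases b <;> simp [F, freeGroupToCoprod]
  have hker : Subgroup.normalClosure {relWord R ^ n} ≤ F.ker := by
    refine Subgroup.normalClosure_le_normal ?_
    rw [Set.singleton_subset_iff, SetLike.mem_coe, MonoidHom.mem_ker, map_pow,
      ← freeGroupToCoprod_mk_flattenRel, ← MonoidHom.comp_apply, hF, hfR]
  refine ⟨Q, hQ, hQfin, QuotientGroup.lift _ F hker, ?_⟩
  rw [FreeGroup.mk_toWord, ← hF] at hfu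
  exact hfu
end
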